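/- Let h = 2n+1 be an odd integer with n ≥ 1, let 0 ≤ i ≤ n, let σ be an h-bar-core with exactly k ≥ 1 addable i-nodes and let τ = ψ_i(σ), so that P_{σ,2} and P_{τ,2} form a [2:k]-pair of residue i; assume either i ≥ 1 or k ≥ 3. If λ ∈ P_{σ,2} has no removable i-node, then ∂ψ_i(λ) = ∂λ. -/

import Mathlib

/-- A partition: a weakly decreasing sequence of non-negative integers with
finite sum (finitely many nonzero parts), indexed from 0 (so `parts 0` is λ₁). -/
structure BPartition where
  parts : ℕ →₀ ℕ
  antitone : ∀ r, parts (r + 1) ≤ parts r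

namespace BPartition

/-- The multiset of positive parts of a partition. -/
def partsM (lam : BPartition) : Multiset ℕ :=
  lam.parts.support.val.map (fun r => lam.parts r)

/-- The Young diagram: nodes `(r, c)` with rows indexed from 0 and columns from 1. -/
def diagram (lam : BPartition) : Set (ℕ × ℕ) :=
  {x | 1 ≤ x.2 ∧ x.2 ≤ lam.parts x.1}

/-- A partition is strict if λ_r > λ_{r+1} whenever λ_r > 0. -/
def IsStrict (lam : BPartition) : Prop :=
  ∀ r, 0 < lam.parts r → lam.parts (r + 1) < lam.parts r

/-- A partition is h-strict if each part is either strictly bigger than the next,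
or positive and divisible by h, or zero. -/
def IsHStrict (h : ℕ) (lam : BPartition) : Prop :=
  ∀ r, lam.parts (r + 1) < lam.parts r ∨ (0 < lam.parts r ∧ h ∣ lam.parts r) ∨ lam.parts r = 0

/-- An h-strict partition is restricted if for every r either λ_{r+1} > λ_r − h,
or λ_{r+1} = λ_r − h and h does not divide λ_r. -/
def IsRestricted (h : ℕ) (lam : BPartition) : Prop :=
  ∀ r, lam.parts r < lam.parts (r + 1) + h ∨
    (lam.parts (r + 1) + h = lam.parts r ∧ ¬ h ∣ lam.parts r)

/-- The residue of a node in column c (1-indexed): the smaller of the residues of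
c − 1 and of −c modulo h. -/
def colRes (h c : ℕ) : ℕ := min ((c - 1) % h) ((h - c % h) % h)

/-- `x` is an addable i-node of `lam`. -/
def Addable (h i : ℕ) (lam : BPartition) (x : ℕ × ℕ) : Prop :=
  colRes h x.2 = i ∧ x ∉ diagram lam ∧
  ∃ nu : BPartition, IsHStrict h nu ∧ diagram lam ⊆ diagram nu ∧ x ∈ diagram nu ∧
    ∀ y ∈ diagram nu, y ∉ diagram lam → colRes h y.2 = i

/-- `x` is a removable i-node of `lam`. -/
def Removable (h i : ℕ) (lam : BPartition) (x : ℕ × ℕ) : Prop :=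
  x ∈ diagram lam ∧
  ∃ mu : BPartition, IsHStrict h mu ∧ diagram mu ⊆ diagram lam ∧ x ∉ diagram mu ∧
    ∀ y ∈ diagram lam, y ∉ diagram mu → colRes h y.2 = i

/-- Removal of a single h-bar from `lam` giving `mu`, recording the value `v`:
either a part `v ≥ h` is replaced by `v − h` (deleted if `v = h`), or two parts
summing to `h` are deleted, in which case `v` is the larger of the two. -/
def barStepRec (h : ℕ) (lam mu : BPartition) (v : ℕ) : Prop :=
  IsHStrict h mu ∧
  ((v = h ∧ v ∈ partsM lam ∧ partsM mu = (partsM lam).erase v) ∨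
   (h < v ∧ v ∈ partsM lam ∧ partsM mu = (v - h) ::ₘ (partsM lam).erase v) ∨
   (∃ a b : ℕ, a + b = h ∧ a ∈ partsM lam ∧ b ∈ (partsM lam).erase a ∧
      v = max a b ∧ partsM mu = ((partsM lam).erase a).erase b))

/-- Removal of a single h-bar. -/
def barStep (h : ℕ) (lam mu : BPartition) : Prop :=
  ∃ v, barStepRec h lam mu v

/-- An h-bar-core: an h-strict partition from which no h-bar can be removed. -/
def IsBarCore (h : ℕ) (lam : BPartition) : Prop :=
  IsHStrict h lam ∧ ∀ mu, ¬ barStep h lam mu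

/-- A chain of `w` h-bar removals from `lam` down to `mu`. -/
def barChain (h : ℕ) : ℕ → BPartition → BPartition → Prop
  | 0, lam, mu => lam = mu
  | w + 1, lam, mu => ∃ nu, barStep h lam nu ∧ barChain h w nu mu

/-- `lam ∈ P_{τ,w}`: `lam` is h-strict with h-bar-core `tau` and h-bar-weight `w`. -/
def InBlock (h : ℕ) (tau : BPartition) (w : ℕ) (lam : BPartition) : Prop :=
  IsHStrict h lam ∧ IsBarCore h tau ∧ barChain h w lam tau

/-- The left-to-right order on node positions along the edge of a Young diagram:
smaller column first; within a column, larger row first. -/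
def posLE (x y : ℕ × ℕ) : Prop := x.2 < y.2 ∨ (x.2 = y.2 ∧ y.1 ≤ x.1)

/-- `x` is a normal i-node: a removable i-node surviving (as a − sign) in the
reduced i-signature; equivalently, every window of the i-signature ending at `x`
contains strictly more removable than addable i-nodes. -/
def Normal (h i : ℕ) (lam : BPartition) (x : ℕ × ℕ) : Prop :=
  Removable h i lam x ∧ ∀ z : ℕ × ℕ, posLE z x →
    Set.ncard {y | Addable h i lam y ∧ posLE z y ∧ posLE y x} <
      Set.ncard {y | Removable h i lam y ∧ posLE z y ∧ posLE y x}

/-- `x` is a conormal i-node: an addable i-node surviving (as a + sign) in the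
reduced i-signature. -/
def Conormal (h i : ℕ) (lam : BPartition) (x : ℕ × ℕ) : Prop :=
  Addable h i lam x ∧ ∀ z : ℕ × ℕ, posLE x z →
    Set.ncard {y | Removable h i lam y ∧ posLE x y ∧ posLE y z} <
      Set.ncard {y | Addable h i lam y ∧ posLE x y ∧ posLE y z}

/-- The node set of ψ_i(λ): add the leftmost s − r conormal i-nodes if s ≥ r,
remove the rightmost r − s normal i-nodes if r > s, where r = #normal and
s = #conormal i-nodes. -/
noncomputable def psiSet (h i : ℕ) (lam : BPartition) : Set (ℕ × ℕ) :=
  if Set.ncard {x | Normal h i lam x} ≤ Set.ncard {x | Conormal h i lam x} then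
    diagram lam ∪ {x | Conormal h i lam x ∧
      Set.ncard {y | Conormal h i lam y ∧ posLE y x} ≤
        Set.ncard {x | Conormal h i lam x} - Set.ncard {x | Normal h i lam x}}
  else
    diagram lam \ {x | Normal h i lam x ∧
      Set.ncard {y | Normal h i lam y ∧ posLE x y} ≤
        Set.ncard {x | Normal h i lam x} - Set.ncard {x | Conormal h i lam x}}

open Classical in
/-- The involution ψ_i. -/
noncomputable def psi (h i : ℕ) (lam : BPartition) : BPartition :=
  if hex : ∃ mu : BPartition, diagram mu = psiSet h i lam then hex.choose else lam

/-- The set of occupied positions of the abacus display of a strict partition. -/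
def abacus (lam : BPartition) : Set ℤ :=
  {a | a = 0 ∨ (0 < a ∧ a.toNat ∈ partsM lam) ∨ (a < 0 ∧ (-a).toNat ∉ partsM lam)}

/-- The dominance order: λ ⊴ μ. -/
def domLE (lam mu : BPartition) : Prop :=
  ∀ r, ∑ s ∈ Finset.range r, lam.parts s ≤ ∑ s ∈ Finset.range r, mu.parts s

/-- Strict dominance: λ ◁ μ. -/
def domLT (lam mu : BPartition) : Prop := domLE lam mu ∧ lam ≠ mu

/-- Lexicographic order: λ <lex μ. -/
def lexLT (lam mu : BPartition) : Prop :=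
  ∃ r, lam.parts r < mu.parts r ∧ ∀ s < r, lam.parts s = mu.parts s

/-- Colexicographic order: λ <colex μ. -/
def colexLT (lam mu : BPartition) : Prop :=
  ∃ r, mu.parts r < lam.parts r ∧ ∀ s, r < s → lam.parts s = mu.parts s

/-- λ ↔ᵢ μ: every node of the symmetric difference of the diagrams has residue i. -/
def Link (h i : ℕ) (lam mu : BPartition) : Prop :=
  ∀ x : ℕ × ℕ, x ∈ (diagram lam \ diagram mu) ∪ (diagram mu \ diagram lam) →
    colRes h x.2 = i

/-- `a ≤ b` are the bar positions of `lam ∈ P_{τ,2}`: the values recorded by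
some two-step removal of h-bars from `lam` down to `tau`. -/
def BarPositions (h : ℕ) (tau lam : BPartition) (a b : ℕ) : Prop :=
  a ≤ b ∧ ∃ (nu : BPartition) (v₁ v₂ : ℕ), barStepRec h lam nu v₁ ∧ barStepRec h nu tau v₂ ∧
    ({a, b} : Multiset ℕ) = {v₁, v₂}

/-- The leg length of the bar of `lam ∈ P_{τ,2}` at bar position `c`. -/
noncomputable def legLen (h : ℕ) (tau lam : BPartition) (c : ℕ) : ℕ :=
  if h ≤ c then Set.ncard {x : ℕ | c - h < x ∧ x < c ∧ x ∈ partsM lam ∧ x ∈ partsM tau}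
  else (h - c) + Set.ncard {x : ℕ | h - c < x ∧ x < c ∧ x ∈ partsM lam ∧ x ∈ partsM tau}

/-- ∂λ: the absolute difference of the two leg lengths of `lam`, whose bar
positions are `a ≤ b`. -/
noncomputable def ddd (h : ℕ) (tau lam : BPartition) (a b : ℕ) : ℕ :=
  max (legLen h tau lam a) (legLen h tau lam b) - min (legLen h tau lam a) (legLen h tau lam b)

inductive Colour | black | white | grey
deriving DecidableEq

/-- β(τ): the number of parts of τ less than h. -/
def betaCount (h : ℕ) (tau : BPartition) : ℕ :=
  Multiset.card ((partsM tau).filter (fun x => x < h))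

/-- The leg length of a 2h-bar of `lam` with larger bar position `b`. -/
noncomputable def legLen2 (h : ℕ) (tau lam : BPartition) (b : ℕ) : ℕ :=
  if 2 * h ≤ b then Set.ncard {x : ℕ | b - 2 * h < x ∧ x < b ∧ x ∈ partsM lam ∧ x ∈ partsM tau}
  else (2 * h - b) + Set.ncard {x : ℕ | 2 * h - b < x ∧ x < b ∧ x ∈ partsM lam ∧ x ∈ partsM tau}

/-- The colour of `lam ∈ P_{τ,2}` with bar positions `a ≤ b`. -/
noncomputable def colour (h : ℕ) (tau lam : BPartition) (a b : ℕ) : Colour :=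
  if 2 ≤ ddd h tau lam a b then Colour.grey
  else if ddd h tau lam a b = 1 then
    if h < b then Colour.grey
    else if (min (legLen h tau lam a) (legLen h tau lam b) + betaCount h tau) % 2 = 1 then
      Colour.black else Colour.white
  else
    if b = a + h ∨ a + b = 2 * h then
      if (legLen2 h tau lam b + 2 * betaCount h tau) % 4 = 0 ∨
         (legLen2 h tau lam b + 2 * betaCount h tau) % 4 = 3 then Colour.black
      else Colour.white
    else
      if (legLen h tau lam a + betaCount h tau) % 2 = 1 then Colour.black else Colour.white

end BPartition

namespace BPartition

theorem anti (mu : BPartition) {r s : ℕ} (hrs : r ≤ s) : mu.parts s ≤ mu.parts r :=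
  antitone_nat_of_succ_le mu.antitone hrs

theorem mem_partsM (mu : BPartition) (x : ℕ) : x ∈ partsM mu ↔ x ≠ 0 ∧ ∃ r, mu.parts r = x := by
  unfold partsM
  simp only [Multiset.mem_map, Finset.mem_val, Finsupp.mem_support_iff]
  constructor
  · rintro ⟨r, h1, h2⟩; exact ⟨h2 ▸ h1, r, h2⟩
  · rintro ⟨h1, r, h2⟩; exact ⟨r, h2 ▸ h1, h2⟩

theorem zero_not_mem (mu : BPartition) : 0 ∉ partsM mu := by
  rw [mem_partsM]; simp

theorem fin_ge (mu : BPartition) (x : ℕ) (hx : 1 ≤ x) : {r | x ≤ mu.parts r}.Finite := by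
  refine Set.Finite.subset mu.parts.support.finite_toSet ?_
  intro r hr
  simp only [Set.mem_ofPred_eq] at hr
  simp only [Finset.mem_coe, Finsupp.mem_support_iff]; omega

theorem fin_eq (mu : BPartition) (x : ℕ) (hx : 1 ≤ x) : {r | mu.parts r = x}.Finite :=
  (fin_ge mu x hx).subset (fun r hr => by simp only [Set.mem_ofPred_eq] at *; omega)

/-- multiplicity -/
def m (mu : BPartition) (x : ℕ) : ℕ := (partsM mu).count x

theorem mem_iff_m (mu : BPartition) (x : ℕ) : x ∈ partsM mu ↔ 1 ≤ m mu x := by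
  unfold m; rw [Multiset.one_le_count_iff_mem]

theorem m_zero (mu : BPartition) : m mu 0 = 0 := by
  have h := zero_not_mem mu
  rw [mem_iff_m] at h; omega

theorem m_eq_ncard (mu : BPartition) (x : ℕ) (hx : 1 ≤ x) :
    m mu x = Set.ncard {r | mu.parts r = x} := by
  classical
  have : {r | mu.parts r = x} = ((mu.parts.support.filter (fun r => x = mu.parts r) : Finset ℕ) : Set ℕ) := by
    ext r
    simp only [Set.mem_ofPred_eq, Finset.coe_filter, Finsupp.mem_support_iff]
    constructor
    · intro h; exact ⟨by omega, h.symm⟩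
    · intro h; exact h.2.symm
  rw [this, Set.ncard_coe_finset]
  unfold m partsM
  rw [Multiset.count_map]
  rfl

/-- column length -/
noncomputable def C (mu : BPartition) (x : ℕ) : ℕ := Set.ncard {r | x ≤ mu.parts r}

theorem C_succ (mu : BPartition) (x : ℕ) (hx : 1 ≤ x) : C mu x = m mu x + C mu (x+1) := by
  rw [m_eq_ncard mu x hx]
  unfold C
  rw [← Set.ncard_union_eq _ (fin_eq mu x hx) (fin_ge mu (x+1) (by omega))]
  · congr 1; ext r; simp only [Set.mem_ofPred_eq, Set.mem_union]; omega
  · rw [Set.disjoint_left]; intro r; simp only [Set.mem_ofPred_eq]; omega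

theorem C_lt {mu nu : BPartition} {c r : ℕ} (hc : 1 ≤ c) (hle : ∀ s, mu.parts s ≤ nu.parts s)
    (h1 : mu.parts r < c) (h2 : c ≤ nu.parts r) : C mu c < C nu c := by
  unfold C
  apply Set.ncard_lt_ncard _ (fin_ge nu c hc)
  refine ⟨fun s hs => ?_, fun hh => ?_⟩
  · have := hle s; simp only [Set.mem_ofPred_eq] at *; omega
  · have := hh (show r ∈ {r | c ≤ nu.parts r} from h2)
    simp only [Set.mem_ofPred_eq] at this; omega

theorem C_le {mu nu : BPartition} {c : ℕ} (hc : 1 ≤ c) (hle : ∀ s, mu.parts s ≤ nu.parts s) :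
    C mu c ≤ C nu c := by
  unfold C
  apply Set.ncard_le_ncard _ (fin_ge nu c hc)
  intro s hs
  have := hle s; simp only [Set.mem_ofPred_eq] at *; omega

theorem m_le_one {h : ℕ} {mu : BPartition} (hs : IsHStrict h mu) {x : ℕ} (hx : ¬ h ∣ x) :
    m mu x ≤ 1 := by
  have hx0 : 1 ≤ x := by
    rcases Nat.eq_zero_or_pos x with h0 | h0
    · subst h0; simp at hx
    · exact h0
  rw [m_eq_ncard mu x hx0, Set.ncard_le_one (fin_eq mu x hx0)]
  have key : ∀ r s, mu.parts r = x → mu.parts s = x → r < s → False := by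
    intro r s hr hs' hlt
    have h1 := anti mu (show r + 1 ≤ s from hlt)
    have h2 := mu.antitone r
    rcases hs r with h3 | h3 | h3
    · omega
    · rw [hr] at h3; exact hx h3.2
    · omega
  intro r hr s hs'
  simp only [Set.mem_ofPred_eq] at hr hs'
  rcases lt_trichotomy r s with h1 | h1 | h1
  · exact (key r s hr hs' h1).elim
  · exact h1
  · exact (key s r hs' hr h1).elim

theorem hstrict_of_m {h : ℕ} {mu : BPartition} (hm : ∀ x, ¬ h ∣ x → m mu x ≤ 1) : IsHStrict h mu := by
  intro r
  by_cases h0 : mu.parts r = 0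
  · right; right; exact h0
  by_cases h1 : h ∣ mu.parts r
  · right; left; exact ⟨by omega, h1⟩
  left
  by_contra hcon
  have h2 := mu.antitone r
  have h3 := hm _ h1
  rw [m_eq_ncard _ _ (by omega), Set.ncard_le_one (fin_eq mu _ (by omega))] at h3
  have := h3 r rfl (r+1) (by simp only [Set.mem_ofPred_eq]; omega)
  omega

theorem exists_of_multiset (M : Multiset ℕ) (h0 : 0 ∉ M) : ∃ mu : BPartition, partsM mu = M := by
  classical
  set l := M.sort (· ≥ ·) with hl
  have hsort : l.Pairwise (· ≥ ·) := Multiset.pairwise_sort _ _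
  have hpos : ∀ r (hr : r < l.length), l[r] ≠ 0 := by
    intro r hr h1
    apply h0
    rw [← Multiset.mem_sort (· ≥ ·), ← hl, ← h1]
    exact List.getElem_mem hr
  let f : ℕ →₀ ℕ := ⟨Finset.range l.length, fun r => l.getD r 0, by
    intro r
    rw [Finset.mem_range]
    constructor
    · intro hr
      rw [List.getD_eq_getElem _ _ hr]; exact hpos r hr
    · intro hr
      by_contra h2
      exact hr (List.getD_eq_default _ _ (by omega))⟩
  have hf : ∀ r, f r = l.getD r 0 := fun r => rfl
  have hanti : ∀ r, f (r + 1) ≤ f r := by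
    intro r
    rw [hf, hf]
    by_cases hr : r + 1 < l.length
    · rw [List.getD_eq_getElem _ _ hr, List.getD_eq_getElem _ _ (by omega)]
      exact List.pairwise_iff_getElem.mp hsort r (r+1) (by omega) hr (by omega)
    · rw [List.getD_eq_default _ _ (by omega)]; exact Nat.zero_le _
  refine ⟨⟨f, hanti⟩, ?_⟩
  · have h3 : M = (l : Multiset ℕ) := by rw [hl]; simp
    have : partsM ⟨f, hanti⟩ = ((List.range l.length).map (fun r => l.getD r 0) : List ℕ) := rfl
    rw [this, h3]
    congr 1
    apply List.ext_getElem
    · simp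
    · intro k h1 h2
      rw [List.getElem_map, List.getElem_range, List.getD_eq_getElem _ _ h2]

/-- Numeric effect of a bar removal. -/
theorem step_rel {n h : ℕ} (hh : h = 2 * n + 1) {lam mu : BPartition} {v : ℕ}
    (hst : barStepRec h lam mu v) : n < v ∧ ∀ x, 1 ≤ x →
    m lam x + (if v = x + h then 1 else 0) =
      m mu x + (if v = x then 1 else 0) + (if v + x = h then 1 else 0) := by
  obtain ⟨-, h1 | h1 | h1⟩ := hst
  · obtain ⟨h1, h2, h3⟩ := h1
    refine ⟨by omega, fun x hx => ?_⟩
    have h4 : partsM lam = v ::ₘ partsM mu := by rw [h3, Multiset.cons_erase h2]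
    unfold m
    rw [h4, Multiset.count_cons]
    split_ifs <;> omega
  · obtain ⟨h1, h2, h3⟩ := h1
    refine ⟨by omega, fun x hx => ?_⟩
    have h4 : partsM lam = v ::ₘ (partsM lam).erase v := by rw [Multiset.cons_erase h2]
    unfold m
    rw [h3, h4, Multiset.count_cons, Multiset.count_cons, Multiset.erase_cons_head]
    split_ifs <;> omega
  · obtain ⟨a, b, h1, h2, h3, h4, h5⟩ := h1
    have ha : a ≠ 0 := fun h0 => zero_not_mem lam (h0 ▸ h2)
    have hb : b ≠ 0 := fun h0 => zero_not_mem lam (h0 ▸ Multiset.mem_of_mem_erase h3)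
    refine ⟨by omega, fun x hx => ?_⟩
    have h6 : partsM lam = a ::ₘ b ::ₘ partsM mu := by
      rw [h5, Multiset.cons_erase h3, Multiset.cons_erase h2]
    unfold m
    rw [h6, Multiset.count_cons, Multiset.count_cons]
    split_ifs <;> omega

theorem core_facts {n h : ℕ} (hh : h = 2 * n + 1) {sg : BPartition} (hc : IsBarCore h sg) :
    (∀ x, h ∣ x → m sg x = 0) ∧ (∀ x, 1 ≤ x → 1 ≤ m sg (x + h) → 1 ≤ m sg x) ∧
    (∀ x y, x + y = h → 1 ≤ m sg x → 1 ≤ m sg y → False) := by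
  obtain ⟨hs, hno⟩ := hc
  have hle : ∀ x, ¬ h ∣ x → m sg x ≤ 1 := fun x hx => m_le_one hs hx
  refine ⟨?_, ?_, ?_⟩
  · intro x hx
    by_contra hcon
    have hmem : x ∈ partsM sg := by rw [mem_iff_m]; omega
    have hx0 : x ≠ 0 := by rintro rfl; exact zero_not_mem _ hmem
    have hxh : h ≤ x := Nat.le_of_dvd (by omega) hx
    rcases Nat.eq_or_lt_of_le hxh with he | hlt
    · obtain ⟨mu, hmu⟩ := exists_of_multiset ((partsM sg).erase x)
        (fun h0 => zero_not_mem sg (Multiset.mem_of_mem_erase h0))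
      refine hno mu ⟨x, hstrict_of_m ?_, Or.inl ⟨he.symm, hmem, hmu⟩⟩
      intro y hy
      refine le_trans ?_ (hle y hy)
      unfold m
      rw [hmu]
      exact Multiset.count_le_of_le _ (Multiset.erase_le _ _)
    · obtain ⟨mu, hmu⟩ := exists_of_multiset ((x - h) ::ₘ (partsM sg).erase x)
        (fun h0 => by
          rw [Multiset.mem_cons] at h0
          rcases h0 with h0 | h0
          · omega
          · exact zero_not_mem sg (Multiset.mem_of_mem_erase h0))
      refine hno mu ⟨x, hstrict_of_m ?_, Or.inr (Or.inl ⟨hlt, hmem, hmu⟩)⟩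
      intro y hy
      refine le_trans ?_ (hle y hy)
      unfold m
      rw [hmu, Multiset.count_cons_of_ne]
      · exact Multiset.count_le_of_le _ (Multiset.erase_le _ _)
      · rintro rfl; exact hy (Nat.dvd_sub hx (dvd_refl _))
  · intro x hx hxh
    by_contra hcon
    have hmem : x + h ∈ partsM sg := by rw [mem_iff_m]; omega
    obtain ⟨mu, hmu⟩ := exists_of_multiset (x ::ₘ (partsM sg).erase (x + h))
        (fun h0 => by
          rw [Multiset.mem_cons] at h0
          rcases h0 with h0 | h0
          · omega
          · exact zero_not_mem sg (Multiset.mem_of_mem_erase h0))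
    refine hno mu ⟨x + h, hstrict_of_m ?_, Or.inr (Or.inl ⟨by omega, hmem, by simpa using hmu⟩)⟩
    intro y hy
    have h1 := hle y hy
    have h2 : ((partsM sg).erase (x + h)).count y ≤ (partsM sg).count y :=
      Multiset.count_le_of_le _ (Multiset.erase_le _ _)
    unfold m at *
    rw [hmu, Multiset.count_cons]
    split_ifs with h3
    · subst h3; omega
    · omega
  · intro x y hxy hx hy
    have hmx : x ∈ partsM sg := by rw [mem_iff_m]; omega
    have hmy : y ∈ partsM sg := by rw [mem_iff_m]; omega
    have hmy' : y ∈ (partsM sg).erase x := by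
      rw [Multiset.mem_erase_of_ne (by omega)]; exact hmy
    obtain ⟨mu, hmu⟩ := exists_of_multiset (((partsM sg).erase x).erase y)
        (fun h0 => zero_not_mem sg (Multiset.mem_of_mem_erase (Multiset.mem_of_mem_erase h0)))
    refine hno mu ⟨max x y, hstrict_of_m ?_, Or.inr (Or.inr ⟨x, y, hxy, hmx, hmy', rfl, hmu⟩)⟩
    intro z hz
    refine le_trans ?_ (hle z hz)
    unfold m
    rw [hmu]
    exact Multiset.count_le_of_le _ (le_trans (Multiset.erase_le _ _) (Multiset.erase_le _ _))

end BPartition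

namespace BPartition

/-- rows of length x can get an i-node in column x+1. -/
def V (h i x : ℕ) : Prop := x % h = i ∨ x % h + i + 1 = h

theorem succ_mod {h : ℕ} (h3 : 2 ≤ h) (x : ℕ) :
    (x % h + 1 = h ∧ (x + 1) % h = 0) ∨ (x % h + 1 < h ∧ (x + 1) % h = x % h + 1) := by
  have hlt := Nat.mod_lt x (show 0 < h by omega)
  have h1 : (x + 1) % h = (x % h + 1) % h := by
    rw [Nat.add_mod, Nat.mod_eq_of_lt (show 1 < h by omega)]
  rcases Nat.lt_or_ge (x % h + 1) h with h2 | h2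
  · right; exact ⟨h2, by rw [h1, Nat.mod_eq_of_lt h2]⟩
  · left; 
    have : x % h + 1 = h := by omega
    exact ⟨this, by rw [h1, this, Nat.mod_self]⟩

theorem colRes_iff {n h i : ℕ} (hn : 1 ≤ n) (hh : h = 2 * n + 1) (hi : i ≤ n) (x : ℕ) :
    colRes h (x + 1) = i ↔ V h i x := by
  unfold colRes V
  rw [Nat.add_sub_cancel]
  have hlt := Nat.mod_lt x (show 0 < h by omega)
  rcases succ_mod (show 2 ≤ h by omega) x with ⟨h1, h2⟩ | ⟨h1, h2⟩
  · rw [h2, Nat.sub_zero, Nat.mod_self]; omega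
  · rw [h2, Nat.mod_eq_of_lt (show h - (x % h + 1) < h by omega)]; omega

def Ext (h i : ℕ) (mu nu : BPartition) : Prop :=
  IsHStrict h nu ∧ (∀ r, mu.parts r ≤ nu.parts r) ∧ ∀ r x, mu.parts r ≤ x → x < nu.parts r → V h i x

theorem diag_sub {mu nu : BPartition} : diagram mu ⊆ diagram nu ↔ ∀ r, mu.parts r ≤ nu.parts r := by
  constructor
  · intro hs r
    rcases Nat.eq_zero_or_pos (mu.parts r) with h0 | h0
    · omega
    · exact (hs (show (r, mu.parts r) ∈ diagram mu from ⟨h0, le_refl _⟩)).2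
  · rintro hs ⟨r, c⟩ ⟨h1, h2⟩
    exact ⟨h1, le_trans h2 (hs r)⟩

theorem ext_iff_diag {n h i : ℕ} (hn : 1 ≤ n) (hh : h = 2 * n + 1) (hi : i ≤ n) (mu nu : BPartition) :
    Ext h i mu nu ↔ IsHStrict h nu ∧ diagram mu ⊆ diagram nu ∧
      ∀ y ∈ diagram nu, y ∉ diagram mu → colRes h y.2 = i := by
  unfold Ext
  rw [diag_sub]
  refine and_congr_right fun _ => and_congr_right fun _ => ?_
  constructor
  · rintro hV ⟨r, c⟩ ⟨h1, h2⟩ h3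
    simp only at h1 h2
    obtain ⟨x, rfl⟩ : ∃ x, c = x + 1 := ⟨c - 1, by omega⟩
    refine (colRes_iff hn hh hi x).2 (hV r x ?_ (by omega))
    by_contra hcon
    exact h3 ⟨h1, by simp only; omega⟩
  · intro hD r x h1 h2
    refine (colRes_iff hn hh hi x).1 (hD (r, x+1) ⟨by simp only; omega, by simp only; omega⟩ ?_)
    rintro ⟨-, h3⟩
    simp only at h3; omega

theorem addable_iff {n h i : ℕ} (hn : 1 ≤ n) (hh : h = 2 * n + 1) (hi : i ≤ n) (mu : BPartition) (y : ℕ × ℕ) :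
    Addable h i mu y ↔ y ∉ diagram mu ∧ ∃ nu, Ext h i mu nu ∧ y ∈ diagram nu := by
  unfold Addable
  constructor
  · rintro ⟨_, h2, nu, h3, h4, h5, h6⟩
    exact ⟨h2, nu, (ext_iff_diag hn hh hi mu nu).2 ⟨h3, h4, h6⟩, h5⟩
  · rintro ⟨h2, nu, h3, h4⟩
    obtain ⟨h5, h6, h7⟩ := (ext_iff_diag hn hh hi mu nu).1 h3
    exact ⟨h7 y h4 h2, h2, nu, h5, h6, h4, h7⟩

theorem removable_iff {n h i : ℕ} (hn : 1 ≤ n) (hh : h = 2 * n + 1) (hi : i ≤ n) (mu : BPartition)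
    (hs : IsHStrict h mu) (y : ℕ × ℕ) :
    Removable h i mu y ↔ y ∈ diagram mu ∧ ∃ nu, IsHStrict h nu ∧ Ext h i nu mu ∧ y ∉ diagram nu := by
  unfold Removable
  constructor
  · rintro ⟨h2, nu, h3, h4, h5, h6⟩
    exact ⟨h2, nu, h3, (ext_iff_diag hn hh hi nu mu).2 ⟨hs, h4, h6⟩, h5⟩
  · rintro ⟨h2, nu, h8, h3, h4⟩
    obtain ⟨h5, h6, h7⟩ := (ext_iff_diag hn hh hi nu mu).1 h3
    exact ⟨h2, nu, h8, h6, h4, h7⟩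

theorem ext_bound {n h i : ℕ} (hn : 1 ≤ n) (hh : h = 2 * n + 1) (hi : i ≤ n) {mu nu : BPartition}
    (he : Ext h i mu nu) (r : ℕ) : nu.parts r ≤ mu.parts r + 2 := by
  by_contra hcon
  have h1 := he.2.2 r (mu.parts r) (by omega) (by omega)
  have h2 := he.2.2 r (mu.parts r + 1) (by omega) (by omega)
  have h3 := he.2.2 r (mu.parts r + 1 + 1) (by omega) (by omega)
  unfold V at h1 h2 h3
  have h4 := succ_mod (show 2 ≤ h by omega) (mu.parts r)
  have h5 := succ_mod (show 2 ≤ h by omega) (mu.parts r + 1)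
  omega

theorem not_V_one {n h i : ℕ} (hn : 1 ≤ n) (hh : h = 2 * n + 1) (h0 : V h i 0) : i = 0 ∨ i + 1 = h := by
  unfold V at h0
  rw [Nat.zero_mod] at h0; omega

theorem ext_zero {n h i : ℕ} (hn : 1 ≤ n) (hh : h = 2 * n + 1) (hi : i ≤ n) {mu nu : BPartition}
    (he : Ext h i mu nu) (r : ℕ) (hr : mu.parts r = 0) : nu.parts (r + 1) = 0 := by
  by_contra hcon
  have ha := nu.antitone r
  have hb := mu.antitone r
  have h1 := he.2.2 r 0 (by omega) (by omega)
  have h2 := not_V_one hn hh h1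
  have h3 : nu.parts r < 2 := by
    by_contra h4
    have h5 := he.2.2 r 1 (by omega) (by omega)
    unfold V at h5
    rw [Nat.mod_eq_of_lt (by omega)] at h5; omega
  rcases he.1 r with h4 | h4 | h4
  · omega
  · have := Nat.le_of_dvd h4.1 h4.2; omega
  · omega

theorem exists_top {n h i : ℕ} (hn : 1 ≤ n) (hh : h = 2 * n + 1) (hi : i ≤ n) (mu : BPartition)
    (hs : IsHStrict h mu) : ∃ nu, Ext h i mu nu ∧ ∀ rho, Ext h i mu rho → ∀ r, rho.parts r ≤ nu.parts r := by
  classical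
  have hself : Ext h i mu mu := ⟨hs, fun _ => le_refl _, fun r x h1 h2 => by omega⟩
  let A : ℕ → Set ℕ := fun r => {x | ∃ nu, Ext h i mu nu ∧ nu.parts r = x}
  have hne : ∀ r, (A r).Nonempty := fun r => ⟨_, mu, hself, rfl⟩
  have hbd : ∀ r, BddAbove (A r) := fun r => ⟨mu.parts r + 2, by
    rintro x ⟨nu, h1, rfl⟩; exact ext_bound hn hh hi h1 r⟩
  have hmem : ∀ r, ∃ nu, Ext h i mu nu ∧ nu.parts r = sSup (A r) := fun r => Nat.sSup_mem (hne r) (hbd r)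
  have hle : ∀ nu, Ext h i mu nu → ∀ r, nu.parts r ≤ sSup (A r) := fun nu he r =>
    le_csSup (hbd r) ⟨nu, he, rfl⟩
  obtain ⟨R, hR⟩ : ∃ R, mu.parts R = 0 := by
    obtain ⟨R, hR⟩ := Infinite.exists_notMem_finset mu.parts.support
    exact ⟨R, by simpa using hR⟩
  have hfin : (Function.support (fun r => sSup (A r))).Finite := by
    refine (Set.finite_le_nat R).subset ?_
    intro r hr
    simp only [Function.mem_support] at hr
    simp only [Set.mem_ofPred_eq]
    by_contra hcon
    obtain ⟨nu, h1, h2⟩ := hmem r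
    have h3 := ext_zero hn hh hi h1 R hR
    have h4 := anti nu (show R + 1 ≤ r by omega)
    omega
  let f : ℕ →₀ ℕ := Finsupp.ofSupportFinite _ hfin
  have hf : ∀ r, f r = sSup (A r) := fun r => rfl
  refine ⟨⟨f, ?_⟩, ⟨?_, ?_, ?_⟩, ?_⟩
  · intro r
    obtain ⟨nu, h1, h2⟩ := hmem (r + 1)
    rw [hf, hf, ← h2]
    exact le_trans (nu.antitone r) (hle nu h1 r)
  · intro r
    show f (r + 1) < f r ∨ (0 < f r ∧ h ∣ f r) ∨ f r = 0
    obtain ⟨nu, h1, h2⟩ := hmem (r + 1)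
    have h3 := hle nu h1 r
    have h4 := nu.antitone r
    rw [hf, hf, ← h2]
    rcases Nat.lt_or_ge (nu.parts (r + 1)) (sSup (A r)) with h5 | h5
    · left; exact h5
    · have h6 : sSup (A r) = nu.parts r := by omega
      rw [h6]
      exact h1.1 r
  · intro r; exact hle mu hself r
  · intro r x h1 h2
    obtain ⟨nu, h3, h4⟩ := hmem r
    exact h3.2.2 r x h1 (by rw [h4]; exact h2)
  · intro rho hr r; exact hle rho hr r

theorem diag_inj {mu nu : BPartition} (h : diagram mu = diagram nu) : mu.parts = nu.parts := by
  have h1 := diag_sub.1 h.le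
  have h2 := diag_sub.1 h.ge
  ext r
  exact le_antisymm (h1 r) (h2 r)

theorem diag_finite (mu : BPartition) : (diagram mu).Finite := by
  refine Set.Finite.subset ((mu.parts.support ×ˢ Finset.range (mu.parts 0 + 1)).finite_toSet) ?_
  rintro ⟨r, c⟩ ⟨h1, h2⟩
  simp only at h1 h2
  have := anti mu (Nat.zero_le r)
  simp only [Finset.coe_product, Set.mem_prod, Finset.mem_coe, Finsupp.mem_support_iff, Finset.mem_range]
  omega

theorem psi_spec {n h i : ℕ} (hn : 1 ≤ n) (hh : h = 2 * n + 1) (hi : i ≤ n) (mu : BPartition)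
    (hs : IsHStrict h mu) (hrem : ∀ x, ¬ Removable h i mu x) :
    Ext h i mu (psi h i mu) ∧ ∀ rho, Ext h i mu rho → ∀ r, rho.parts r ≤ (psi h i mu).parts r := by
  obtain ⟨nu, h1, h2⟩ := exists_top hn hh hi mu hs
  have hadd : ∀ y, Addable h i mu y ↔ y ∈ diagram nu ∧ y ∉ diagram mu := by
    intro y
    rw [addable_iff hn hh hi]
    constructor
    · rintro ⟨h3, rho, h4, h5⟩
      exact ⟨diag_sub.2 (h2 rho h4) h5, h3⟩
    · rintro ⟨h3, h4⟩
      exact ⟨h4, nu, h1, h3⟩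
  have hafin : {y | Addable h i mu y}.Finite :=
    (diag_finite nu).subset (fun y hy => ((hadd y).1 hy).1)
  have hnorm : {x | Normal h i mu x} = ∅ := by
    ext x; simp only [Set.mem_ofPred_eq, Set.mem_empty_iff_false, iff_false]
    intro hx; exact hrem x hx.1
  have hcon : ∀ x, Conormal h i mu x ↔ Addable h i mu x := by
    intro x
    refine ⟨fun hx => hx.1, fun hx => ⟨hx, fun z hz => ?_⟩⟩
    have he : {y | Removable h i mu y ∧ posLE x y ∧ posLE y z} = ∅ := by
      ext y; simp only [Set.mem_ofPred_eq, Set.mem_empty_iff_false, iff_false]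
      intro hy; exact hrem y hy.1
    rw [he, Set.ncard_empty, Set.ncard_pos (hafin.subset (fun y hy => hy.1))]
    exact ⟨x, hx, Or.inr ⟨rfl, le_refl _⟩, hz⟩
  have hset : psiSet h i mu = diagram nu := by
    unfold psiSet
    rw [hnorm, Set.ncard_empty, if_pos (Nat.zero_le _), Nat.sub_zero]
    ext y
    simp only [Set.mem_union, Set.mem_ofPred_eq, hcon]
    constructor
    · rintro (hy | hy)
      · exact diag_sub.2 h1.2.1 hy
      · exact ((hadd y).1 hy.1).1
    · intro hy
      by_cases hm : y ∈ diagram mu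
      · left; exact hm
      · right
        refine ⟨(hadd y).2 ⟨hy, hm⟩, ?_⟩
        exact Set.ncard_le_ncard (fun z hz => hz.1) hafin
  have hpsi : (psi h i mu).parts = nu.parts := by
    have hex : ∃ rho : BPartition, diagram rho = psiSet h i mu := ⟨nu, hset.symm⟩
    unfold psi
    rw [dif_pos hex]
    exact diag_inj (hex.choose_spec.trans hset)
  have hpe : psi h i mu = nu := by
    cases hp : psi h i mu with
    | mk p hp' =>
      rw [hp] at hpsi
      cases nu with
      | mk q hq => 
        simp only at hpsi
        subst hpsi; rfl
  rw [hpe]; exact ⟨h1, h2⟩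

theorem ext_C {h i : ℕ} {mu nu : BPartition} (he : Ext h i mu nu) {x : ℕ} (hx : ¬ V h i x) :
    C nu (x + 1) = C mu (x + 1) := by
  unfold C
  congr 1
  ext r
  simp only [Set.mem_ofPred_eq]
  have h1 := he.2.1 r
  constructor
  · intro h2
    by_contra h3
    exact hx (he.2.2 r x (by omega) (by omega))
  · intro h2; omega

/-- Raise the first row of length x. -/
theorem raise {h i : ℕ} {mu : BPartition} (hs : IsHStrict h mu) {x : ℕ} (hV : V h i x)
    (hx : x = 0 ∨ 1 ≤ m mu x) (hx1 : m mu (x + 1) = 0 ∨ h ∣ x + 1) :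
    ∃ rho, Ext h i mu rho ∧ ∃ r, mu.parts r < rho.parts r := by
  classical
  have hex : ∃ r, mu.parts r = x := by
    rcases hx with hx | hx
    · obtain ⟨R, hR⟩ := Infinite.exists_notMem_finset mu.parts.support
      exact ⟨R, by rw [hx]; simpa using hR⟩
    · exact ((mem_partsM mu x).1 ((mem_iff_m mu x).2 hx)).2
  let r := Nat.find hex
  have hr : mu.parts r = x := Nat.find_spec hex
  have hmin : ∀ s, s < r → x < mu.parts s := by
    intro s hs'
    have h1 := Nat.find_min hex hs'
    have h2 := anti mu hs'.le
    omega
  have hup : ∀ s, (mu.parts.update r (x + 1)) s = if s = r then x + 1 else mu.parts s := by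
    intro s; rw [Finsupp.coe_update, Function.update_apply]
  refine ⟨⟨mu.parts.update r (x + 1), ?_⟩, ⟨?_, ?_, ?_⟩, r, ?_⟩
  · intro s
    rw [hup, hup]
    have h1 := mu.antitone s
    have h2 := hmin s
    split_ifs with h3 h4 h4
    · omega
    · have := h2 (by omega); omega
    · subst h4; omega
    · exact h1
  · intro s
    show (mu.parts.update r (x + 1)) (s + 1) < (mu.parts.update r (x + 1)) s ∨
      (0 < (mu.parts.update r (x + 1)) s ∧ h ∣ (mu.parts.update r (x + 1)) s) ∨ (mu.parts.update r (x + 1)) s = 0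
    rw [hup, hup]
    have h1 := mu.antitone s
    have h2 := hmin s
    split_ifs with h3 h4 h4
    · omega
    · have h5 := h2 (by omega)
      rcases Nat.lt_or_ge (x + 1) (mu.parts s) with h6 | h6
      · left; exact h6
      · have h7 : mu.parts s = x + 1 := by omega
        rcases hx1 with h8 | h8
        · have : x + 1 ∈ partsM mu := (mem_partsM mu _).2 ⟨by omega, s, h7⟩
          rw [mem_iff_m] at this; omega
        · right; left; rw [h7]; exact ⟨by omega, h8⟩
    · left; subst h4; omega
    · exact hs s
  · intro s
    show mu.parts s ≤ (mu.parts.update r (x + 1)) s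
    rw [hup]; split_ifs with h3
    · subst h3; omega
    · exact le_refl _
  · intro s y h1 h2
    change y < (mu.parts.update r (x + 1)) s at h2
    rw [hup] at h2; split_ifs at h2 with h3
    · subst h3
      have : y = x := by omega
      rw [this]; exact hV
    · omega
  · show mu.parts r < (mu.parts.update r (x + 1)) r
    rw [hup, if_pos rfl]; omega

/-- Lower the last row of length x+1. -/
theorem lower {h i : ℕ} {mu : BPartition} (hs : IsHStrict h mu) {x : ℕ} (hV : V h i x)
    (hx : 1 ≤ m mu (x + 1)) (hx1 : m mu x = 0 ∨ h ∣ x) :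
    ∃ rho, IsHStrict h rho ∧ Ext h i rho mu ∧ ∃ r, rho.parts r < mu.parts r := by
  classical
  have hex0 : ∃ r, mu.parts r = x + 1 := ((mem_partsM mu _).1 ((mem_iff_m mu _).2 hx)).2
  have hex : ∃ r, mu.parts r < x + 1 := by
    obtain ⟨R, hR⟩ := Infinite.exists_notMem_finset mu.parts.support
    exact ⟨R, by
      have : mu.parts R = 0 := by simpa using hR
      omega⟩
  obtain ⟨r, hr, hnext⟩ : ∃ r, mu.parts r = x + 1 ∧ mu.parts (r + 1) < x + 1 := by
    obtain ⟨r0, hr0⟩ := hex0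
    have h1 := Nat.find_spec hex
    have h3 : r0 < Nat.find hex := by
      by_contra h4
      have := anti mu (show Nat.find hex ≤ r0 by omega)
      omega
    have h2 := Nat.find_min hex (show Nat.find hex - 1 < Nat.find hex by omega)
    refine ⟨Nat.find hex - 1, ?_, ?_⟩
    · have := anti mu (show r0 ≤ Nat.find hex - 1 by omega)
      omega
    · rw [show Nat.find hex - 1 + 1 = Nat.find hex by omega]; exact h1
  have hup : ∀ s, (mu.parts.update r x) s = if s = r then x else mu.parts s := by
    intro s; rw [Finsupp.coe_update, Function.update_apply]
  refine ⟨⟨mu.parts.update r x, ?_⟩, ?_, ⟨hs, ?_, ?_⟩, r, ?_⟩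
  · intro s
    rw [hup, hup]
    have h1 := mu.antitone s
    split_ifs with h3 h4 h4
    · omega
    · subst h3; omega
    · subst h4; omega
    · exact h1
  · intro s
    show (mu.parts.update r x) (s + 1) < (mu.parts.update r x) s ∨
      (0 < (mu.parts.update r x) s ∧ h ∣ (mu.parts.update r x) s) ∨ (mu.parts.update r x) s = 0
    rw [hup, hup]
    have h1 := mu.antitone s
    split_ifs with h3 h4 h4
    · omega
    · subst h3; left; omega
    · subst h4
      rcases Nat.eq_zero_or_pos x with h5 | h5
      · right; right; exact h5
      rcases hx1 with h6 | h6
      · left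
        rcases Nat.lt_or_ge (mu.parts (s + 1)) x with h7 | h7
        · exact h7
        · have : x ∈ partsM mu := (mem_partsM mu _).2 ⟨by omega, s + 1, by omega⟩
          rw [mem_iff_m] at this; omega
      · right; left; exact ⟨h5, h6⟩
    · exact hs s
  · intro s
    show (mu.parts.update r x) s ≤ mu.parts s
    rw [hup]; split_ifs with h3
    · subst h3; omega
    · exact le_refl _
  · intro s y h1 h2
    change (mu.parts.update r x) s ≤ y at h1
    rw [hup] at h1; split_ifs at h1 with h3
    · subst h3
      have : y = x := by omega
      rw [this]; exact hV
    · omega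
  · show (mu.parts.update r x) r < mu.parts r
    rw [hup, if_pos rfl]; omega

/-- no removable nodes: numeric consequence -/
theorem no_lower {n h i : ℕ} (hn : 1 ≤ n) (hh : h = 2 * n + 1) (hi : i ≤ n) {mu : BPartition}
    (hs : IsHStrict h mu) (hrem : ∀ x, ¬ Removable h i mu x) {x : ℕ} (hV : V h i x)
    (hx : 1 ≤ m mu (x + 1)) : ¬ (m mu x = 0 ∨ h ∣ x) := by
  intro hx1
  obtain ⟨rho, h1, h2, r, h3⟩ := lower hs hV hx hx1
  refine hrem (r, mu.parts r) ((removable_iff hn hh hi mu hs _).2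
    ⟨⟨by simp only; omega, le_refl _⟩, rho, h1, h2, ?_⟩)
  rintro ⟨-, h4⟩
  simp only at h4; omega

/-- psi has no addable nodes: numeric consequence -/
theorem no_raise {n h i : ℕ} (hn : 1 ≤ n) (hh : h = 2 * n + 1) (hi : i ≤ n) {mu : BPartition}
    (hs : IsHStrict h mu) (hrem : ∀ x, ¬ Removable h i mu x) {x : ℕ} (hV : V h i x)
    (hx : x = 0 ∨ 1 ≤ m (psi h i mu) x) : ¬ (m (psi h i mu) (x + 1) = 0 ∨ h ∣ x + 1) := by
  intro hx1
  obtain ⟨h1, h2⟩ := psi_spec hn hh hi mu hs hrem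
  obtain ⟨rho, h3, r, h4⟩ := raise h1.1 hV hx hx1
  have h5 : Ext h i mu rho := by
    refine ⟨h3.1, fun s => le_trans (h1.2.1 s) (h3.2.1 s), fun s y h6 h7 => ?_⟩
    rcases Nat.lt_or_ge y ((psi h i mu).parts s) with h8 | h8
    · exact h1.2.2 s y h6 h8
    · exact h3.2.2 s y h8 h7
  have := h2 rho h5 r
  omega

end BPartition

namespace BPartition

theorem V_add {h i x : ℕ} : V h i (x + h) ↔ V h i x := by
  unfold V; rw [Nat.add_mod_right]

theorem V_facts {n h i x : ℕ} (hn : 1 ≤ n) (hh : h = 2 * n + 1) (hi1 : 1 ≤ i) (hi : i ≤ n) (hV : V h i x) :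
    ¬ V h i (x + 1) ∧ 1 ≤ x ∧ ¬ h ∣ x ∧ ¬ h ∣ x + 1 ∧ ¬ V h i (x - 1) := by
  unfold V at *
  rw [Nat.dvd_iff_mod_eq_zero, Nat.dvd_iff_mod_eq_zero]
  have hx : 1 ≤ x := by
    by_contra h0
    have : x = 0 := by omega
    subst this; rw [Nat.zero_mod] at hV; omega
  obtain ⟨y, rfl⟩ : ∃ y, x = y + 1 := ⟨x - 1, by omega⟩
  rw [Nat.add_sub_cancel]
  have h4 := succ_mod (show 2 ≤ h by omega) y
  have h5 := succ_mod (show 2 ≤ h by omega) (y + 1)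
  omega

theorem V_neg {h i x y : ℕ} (hxy : x + y + 1 = h) (hV : V h i x) : V h i y := by
  unfold V at *
  rw [Nat.mod_eq_of_lt (by omega)] at *
  omega

theorem V_small {h i x : ℕ} (hxy : x < h) : V h i x ↔ x = i ∨ x + i + 1 = h := by
  unfold V
  rw [Nat.mod_eq_of_lt (by omega)]

theorem psi_m1 {n h i : ℕ} (hn : 1 ≤ n) (hh : h = 2 * n + 1) (hi1 : 1 ≤ i) (hi : i ≤ n) {mu : BPartition}
    (hs : IsHStrict h mu) (hrem : ∀ x, ¬ Removable h i mu x) :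
    (∀ x, V h i x → m (psi h i mu) x = m mu (x + 1) ∧ m (psi h i mu) (x + 1) = m mu x) ∧
    (∀ x, ¬ V h i x → ¬ V h i (x - 1) → m (psi h i mu) x = m mu x) ∧
    (∀ x, V h i x → 1 ≤ m mu (x + 1) → 1 ≤ m mu x) := by
  obtain ⟨h1, h2⟩ := psi_spec hn hh hi mu hs hrem
  refine ⟨?_, ?_, ?_⟩
  · intro x hV
    obtain ⟨f1, f2, f3, f4, f5⟩ := V_facts hn hh hi1 hi hV
    have a1 := ext_C h1 f1
    have a2 := ext_C h1 f5
    rw [Nat.sub_add_cancel f2] at a2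
    have b1 := C_succ mu x f2
    have b2 := C_succ mu (x+1) (by omega)
    have b3 := C_succ (psi h i mu) x f2
    have b4 := C_succ (psi h i mu) (x+1) (by omega)
    have c1 := m_le_one hs f3
    have c2 := m_le_one hs f4
    have c3 := m_le_one h1.1 f3
    have c4 := m_le_one h1.1 f4
    have d1 := fun hx => no_lower hn hh hi hs hrem hV hx
    have d2 := fun hx => no_raise hn hh hi hs hrem hV hx
    have d3 : 1 ≤ m mu (x+1) → 1 ≤ m mu x := fun hx => by have := d1 hx; omega
    have d4 : 1 ≤ m (psi h i mu) x → 1 ≤ m (psi h i mu) (x + 1) := fun hx => by have := d2 (Or.inr hx); omega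
    omega
  · intro x g1 g2
    rcases Nat.eq_zero_or_pos x with h0 | h0
    · subst h0; rw [m_zero, m_zero]
    · have a1 := ext_C h1 g1
      have a2 := ext_C h1 g2
      rw [Nat.sub_add_cancel h0] at a2
      have b1 := C_succ mu x h0
      have b3 := C_succ (psi h i mu) x h0
      omega
  · intro x hV hx
    have := no_lower hn hh hi hs hrem hV hx
    omega

theorem core_down {h : ℕ} {s : ℕ → ℕ} (hc : ∀ x, 1 ≤ x → 1 ≤ s (x + h) → 1 ≤ s x) (j x : ℕ) (hx : 1 ≤ x)
    (hj : 1 ≤ s (x + j * h)) : 1 ≤ s x := by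
  induction j with
  | zero => simpa using hj
  | succ j ih => 
    apply ih
    apply hc _ (by omega)
    rw [show x + j * h + h = x + (j + 1) * h by ring]; exact hj

theorem sigma_facts1 {n h i : ℕ} (hn : 1 ≤ n) (hh : h = 2 * n + 1) (hi1 : 1 ≤ i) (hi : i ≤ n) {sg : BPartition}
    (hc : IsBarCore h sg) (hadd : ∃ y, Addable h i sg y) :
    (∀ x, V h i x → 1 ≤ m sg (x + 1) → 1 ≤ m sg (x + h)) ∧ (1 ≤ m sg i ∨ 1 ≤ m sg (h - 1 - i)) ∧
    (∀ x, ¬ Removable h i sg x) := by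
  obtain ⟨c1, c2, c3⟩ := core_facts hh hc
  have hs := hc.1
  have hcols : ∀ mu nu : BPartition, IsHStrict h mu → Ext h i mu nu → ∀ r x, mu.parts r < x + 1 → x + 1 ≤ nu.parts r →
      V h i x ∧ m mu x = 1 ∧ m nu (x + 1) = 1 ∧ m mu (x + 1) = 0 ∧ m nu x = 0 := by
    intro mu nu hmu h1 r x h2 h3
    have hV := h1.2.2 r x (by omega) (by omega)
    obtain ⟨f1, f2, f3, f4, f5⟩ := V_facts hn hh hi1 hi hV
    have a1 := ext_C h1 f1
    have a2 := ext_C h1 f5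
    rw [Nat.sub_add_cancel f2] at a2
    have b1 := C_succ mu x f2
    have b2 := C_succ mu (x+1) (by omega)
    have b3 := C_succ nu x f2
    have b4 := C_succ nu (x+1) (by omega)
    have e1 := m_le_one hmu f3
    have e2 := m_le_one hmu f4
    have e3 := m_le_one h1.1 f3
    have e4 := m_le_one h1.1 f4
    have g := C_lt (by omega) h1.2.1 h2 h3
    exact ⟨hV, by omega, by omega, by omega, by omega⟩
  obtain ⟨w, hVw, hw, hw1⟩ : ∃ w, V h i w ∧ 1 ≤ m sg w ∧ m sg (w + 1) = 0 := by
    obtain ⟨⟨r, c⟩, hy⟩ := hadd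
    rw [addable_iff hn hh hi] at hy
    obtain ⟨h1, nu, h2, h3, h4⟩ := hy
    simp only at h3 h4
    obtain ⟨x, rfl⟩ : ∃ x, c = x + 1 := ⟨c - 1, by omega⟩
    have h5 : sg.parts r < x + 1 := by
      by_contra h6; exact h1 ⟨h3, by simp only; omega⟩
    have := hcols sg nu hs h2 r x h5 h4
    exact ⟨x, this.1, by omega, by omega⟩
  have hw0 : 1 ≤ w % h := by
    unfold V at hVw; omega
  have hwm : 1 ≤ m sg (w % h) := by
    apply core_down c2 (w / h) _ hw0
    rw [mul_comm, Nat.mod_add_div]; exact hw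
  have F : ∀ x, V h i x → 1 ≤ m sg (x + 1) → 1 ≤ m sg (x + h) := by
    intro z hVz hz
    have hz0 : 1 ≤ z := (V_facts hn hh hi1 hi hVz).2.1
    have ez : z % h + (z / h) * h = z := by rw [mul_comm]; exact Nat.mod_add_div z h
    have ew : w % h + (w / h) * h = w := by rw [mul_comm]; exact Nat.mod_add_div w h
    by_cases hmod : z % h = w % h
    · rcases Nat.lt_or_ge (z / h) (w / h) with h1 | h1
      · apply core_down c2 (w / h - z / h - 1) _ (by omega)
        have h2 : w / h = z / h + 1 + (w / h - z / h - 1) := by omega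
        have h3 : z + h + (w / h - z / h - 1) * h = w := by
          calc z + h + (w / h - z / h - 1) * h = z % h + (z / h) * h + h + (w / h - z / h - 1) * h := by rw [ez]
            _ = z % h + (z / h + 1 + (w / h - z / h - 1)) * h := by ring
            _ = w := by rw [← h2, hmod, ew]
        rw [h3]; exact hw
      · exfalso
        have h2 : z / h = w / h + (z / h - w / h) := by omega
        have h3 : w + 1 + (z / h - w / h) * h = z + 1 := by
          calc w + 1 + (z / h - w / h) * h = w % h + (w / h) * h + 1 + (z / h - w / h) * h := by rw [ew]
            _ = w % h + (w / h + (z / h - w / h)) * h + 1 := by ring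
            _ = z + 1 := by rw [← h2, ← hmod, ez]
        have := core_down c2 (z / h - w / h) (w + 1) (by omega) (by rw [h3]; exact hz)
        omega
    · exfalso
      have hsum : (z % h + 1) + w % h = h := by
        unfold V at hVz hVw; omega
      refine c3 _ _ hsum ?_ hwm
      apply core_down c2 (z / h) _ (by omega)
      rw [show z % h + 1 + z / h * h = (z % h + z / h * h) + 1 by ring, ez]; exact hz
  refine ⟨F, ?_, ?_⟩
  · unfold V at hVw
    rcases hVw with h1 | h1
    · left; rw [← h1]; exact hwm
    · right; rw [show h - 1 - i = w % h by omega]; exact hwm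
  · rintro ⟨r, c⟩ hy
    rw [removable_iff hn hh hi _ hs] at hy
    obtain ⟨⟨h3, h4⟩, nu, h1, h2, h5⟩ := hy
    simp only at h3 h4
    obtain ⟨x, rfl⟩ : ∃ x, c = x + 1 := ⟨c - 1, by omega⟩
    have h5 : nu.parts r < x + 1 := by
      by_contra h6; exact h5 ⟨h3, by simp only; omega⟩
    obtain ⟨h6, h7, h8, h9, h10⟩ := hcols nu sg h1 h2 r x h5 h4
    have h11 := F x h6 (by omega)
    have h12 := c2 x (V_facts hn hh hi1 hi h6).2.1 h11
    omega

theorem V0 {h x : ℕ} : V h 0 x ↔ x % h = 0 ∨ x % h + 1 = h := Iff.rfl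

/-- i = 0: x = y+1 a positive multiple of h. -/
theorem psi_m0 {n h : ℕ} (hn : 1 ≤ n) (hh : h = 2 * n + 1) {mu : BPartition}
    (hs : IsHStrict h mu) (hrem : ∀ x, ¬ Removable h 0 mu x) :
    (∀ y, h ∣ y + 1 → m (psi h 0 mu) y = 0 ∧ m (psi h 0 mu) (y + 1) = m mu (y + 1) ∧
      m (psi h 0 mu) (y + 2) = m mu y ∧ m mu (y + 2) = 0 ∧ (1 ≤ m mu (y + 1) → 1 ≤ m mu y)) ∧
    (∀ x, x % h ≠ 0 → x % h ≠ 1 → x % h + 1 ≠ h → m (psi h 0 mu) x = m mu x) ∧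
    m (psi h 0 mu) 1 = 1 ∧ m mu 1 = 0 := by
  have hi : 0 ≤ n := Nat.zero_le _
  obtain ⟨h1, h2⟩ := psi_spec hn hh hi mu hs hrem
  have V00 : V h 0 0 := by rw [V0, Nat.zero_mod]; simp
  have h1h : ¬ h ∣ 1 := by intro h3; have := Nat.le_of_dvd (by omega) h3; omega
  refine ⟨?_, ?_, ?_, ?_⟩
  · intro y hy
    rw [Nat.dvd_iff_mod_eq_zero] at hy
    have hy1 : 1 ≤ y := by
      by_contra h0
      have : y = 0 := by omega
      subst this
      rw [Nat.mod_eq_of_lt (by omega)] at hy; omega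
    obtain ⟨z, rfl⟩ : ∃ z, y = z + 1 := ⟨y - 1, by omega⟩
    have s1 := succ_mod (show 2 ≤ h by omega) z
    have s2 := succ_mod (show 2 ≤ h by omega) (z + 1)
    have s3 := succ_mod (show 2 ≤ h by omega) (z + 1 + 1)
    have s4 := succ_mod (show 2 ≤ h by omega) (z + 1 + 1 + 1)
    have f1 : ¬ V h 0 z := by rw [V0]; omega
    have f2 : V h 0 (z + 1) := by rw [V0]; omega
    have f3 : V h 0 (z + 1 + 1) := by rw [V0]; omega
    have f4 : ¬ V h 0 (z + 1 + 1 + 1) := by rw [V0]; omega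
    have d1 : ¬ h ∣ z + 1 := by rw [Nat.dvd_iff_mod_eq_zero]; omega
    have d2 : h ∣ z + 1 + 1 := by rw [Nat.dvd_iff_mod_eq_zero]; omega
    have d3 : ¬ h ∣ z + 1 + 1 + 1 := by rw [Nat.dvd_iff_mod_eq_zero]; omega
    have a1 := ext_C h1 f1
    have a2 := ext_C h1 f4
    have b1 := C_succ mu (z+1) (by omega)
    have b2 := C_succ mu (z+1+1) (by omega)
    have b3 := C_succ mu (z+1+1+1) (by omega)
    have b4 := C_succ (psi h 0 mu) (z+1) (by omega)
    have b5 := C_succ (psi h 0 mu) (z+1+1) (by omega)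
    have b6 := C_succ (psi h 0 mu) (z+1+1+1) (by omega)
    have c1 := m_le_one hs d1
    have c2 := m_le_one h1.1 d3
    have e1 : m (psi h 0 mu) (z + 1) = 0 := by
      by_contra h0
      exact no_raise hn hh hi hs hrem f2 (Or.inr (by omega)) (Or.inr d2)
    have e2 : 1 ≤ m (psi h 0 mu) (z + 1 + 1) → 1 ≤ m (psi h 0 mu) (z + 1 + 1 + 1) := by
      intro h0
      have := no_raise hn hh hi hs hrem f3 (Or.inr h0)
      omega
    have e3 : m mu (z + 1 + 1 + 1) = 0 := by
      by_contra h0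
      exact no_lower hn hh hi hs hrem f3 (by omega) (Or.inr d2)
    have e4 : 1 ≤ m mu (z + 1 + 1) → 1 ≤ m mu (z + 1) := by
      intro h0
      have := no_lower hn hh hi hs hrem f2 h0
      omega
    refine ⟨e1, ?_, ?_, e3, e4⟩
    · omega
    · show m (psi h 0 mu) (z + 1 + 1 + 1) = _
      omega
  · intro x g1 g2 g3
    have h0 : 1 ≤ x := by
      by_contra h0
      have : x = 0 := by omega
      subst this; simp at g1
    obtain ⟨z, rfl⟩ : ∃ z, x = z + 1 := ⟨x - 1, by omega⟩
    have s1 := succ_mod (show 2 ≤ h by omega) z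
    have a1 := ext_C h1 (show ¬ V h 0 (z + 1) by rw [V0]; omega)
    have a2 := ext_C h1 (show ¬ V h 0 z by rw [V0]; omega)
    have b1 := C_succ mu (z + 1) h0
    have b3 := C_succ (psi h 0 mu) (z + 1) h0
    omega
  · have e := no_raise hn hh hi hs hrem V00 (Or.inl rfl)
    have c := m_le_one h1.1 h1h
    rw [Nat.zero_add] at e
    omega
  · by_contra h0
    exact no_lower hn hh hi hs hrem V00 (by rw [Nat.zero_add]; omega) (Or.inr (dvd_zero _))

theorem sigma_facts0 {n h : ℕ} (hn : 1 ≤ n) (hh : h = 2 * n + 1) {sg : BPartition}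
    (hc : IsBarCore h sg) (hadd : 2 ≤ Set.ncard {y | Addable h 0 sg y}) :
    1 ≤ m sg (h - 1) ∧ (∀ x, ¬ Removable h 0 sg x) := by
  obtain ⟨c1, c2, c3⟩ := core_facts hh hc
  have hs := hc.1
  have hi : 0 ≤ n := Nat.zero_le _
  have hpart : ∀ r, 1 ≤ sg.parts r → 1 ≤ m sg (sg.parts r) := by
    intro r hr
    rw [← mem_iff_m, mem_partsM]; exact ⟨by omega, r, rfl⟩
  have hmodpart : ∀ r, 1 ≤ sg.parts r → sg.parts r % h ≠ 0 ∧ 1 ≤ m sg (sg.parts r % h) := by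
    intro r hr
    have h1 : sg.parts r % h ≠ 0 := by
      intro h2
      have := c1 _ (Nat.dvd_of_mod_eq_zero h2)
      have := hpart r hr
      omega
    refine ⟨h1, ?_⟩
    apply core_down c2 (sg.parts r / h) _ (by omega)
    rw [mul_comm, Nat.mod_add_div]; exact hpart r hr
  have key : 1 ≤ m sg (h - 1) := by
    by_contra hno
    have hno' : ∀ r, 1 ≤ sg.parts r → sg.parts r % h ≠ 0 ∧ sg.parts r % h + 1 ≠ h := by
      intro r hr
      obtain ⟨h1, h2⟩ := hmodpart r hr
      refine ⟨h1, fun h3 => hno ?_⟩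
      rw [show h - 1 = sg.parts r % h by omega]; exact h2
    have claim : ∀ r c, Addable h 0 sg (r, c) → c = 1 ∧ sg.parts r = 0 ∧ ∀ s, s < r → sg.parts s ≠ 0 := by
      intro r c hy
      rw [addable_iff hn hh hi] at hy
      obtain ⟨h1, nu, h2, h3, h4⟩ := hy
      simp only at h3 h4
      have h5 : sg.parts r < c := by
        by_contra h6; exact h1 ⟨h3, by simp only; omega⟩
      have hV := h2.2.2 r (sg.parts r) (le_refl _) (by omega)
      have h0 : sg.parts r = 0 := by
        by_contra h7
        have := hno' r (by omega)
        rw [V0] at hV; omega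
      have hc1 : c = 1 := by
        by_contra h7
        have hV := h2.2.2 r 1 (by omega) (by omega)
        rw [V0, Nat.mod_eq_of_lt (by omega)] at hV; omega
      refine ⟨hc1, h0, fun s hs' h8 => ?_⟩
      have := ext_zero hn hh hi h2 s h8
      have := anti nu (show s + 1 ≤ r from hs')
      omega
    have : Set.ncard {y | Addable h 0 sg y} ≤ 1 := by
      rcases Set.finite_or_infinite {y | Addable h 0 sg y} with hf | hf
      · rw [Set.ncard_le_one hf]
        rintro ⟨r, c⟩ h1 ⟨r', c'⟩ h2
        obtain ⟨k1, k2, k3⟩ := claim r c h1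
        obtain ⟨l1, l2, l3⟩ := claim r' c' h2
        have hr : r = r' := by
          rcases lt_trichotomy r r' with h | h | h
          · exact (l3 r h k2).elim
          · exact h
          · exact (k3 r' h l2).elim
        rw [hr, k1, l1]
      · rw [hf.ncard]; omega
    omega
  refine ⟨key, ?_⟩
  have hno' : ∀ r, 1 ≤ sg.parts r → sg.parts r % h ≠ 0 ∧ sg.parts r % h ≠ 1 := by
    intro r hr
    obtain ⟨h1, h2⟩ := hmodpart r hr
    refine ⟨h1, fun h3 => ?_⟩
    rw [h3] at h2
    exact c3 1 (h - 1) (by omega) h2 key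
  rintro ⟨r, c⟩ hy
  rw [removable_iff hn hh hi _ hs] at hy
  obtain ⟨⟨h3, h4⟩, nu, h1, h2, h5⟩ := hy
  simp only at h3 h4
  have h6 : nu.parts r < sg.parts r := by
    by_contra h7
    exact h5 ⟨h3, by simp only; omega⟩
  have hV := h2.2.2 r (sg.parts r - 1) (by omega) (by omega)
  have h8 := hno' r (by omega)
  have h9 := succ_mod (show 2 ≤ h by omega) (sg.parts r - 1)
  rw [Nat.sub_add_cancel (by omega)] at h9
  rw [V0] at hV
  omega

end BPartition

namespace BPartition

def d (a x : ℕ) : ℕ := if a = x then 1 else 0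

theorem d_cases (a x : ℕ) : (a = x ∧ d a x = 1) ∨ (a < x ∧ d a x = 0) ∨ (x < a ∧ d a x = 0) := by
  unfold d; split_ifs <;> omega

def Rel (h : ℕ) (L S : ℕ → ℕ) (a b : ℕ) : Prop := ∀ x, 1 ≤ x →
  L x + d a (x + h) + d b (x + h) = S x + d a x + d b x + d (a + x) h + d (b + x) h

theorem Rel.symm {h : ℕ} {L S : ℕ → ℕ} {a b : ℕ} (hr : Rel h L S a b) : Rel h L S b a := by
  intro x hx; have := hr x hx; omega

theorem rel_of_bar {n h : ℕ} (hh : h = 2 * n + 1) {tau lam : BPartition} {a b : ℕ}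
    (hb : BarPositions h tau lam a b) : n < a ∧ n < b ∧ Rel h (m lam) (m tau) a b := by
  obtain ⟨-, nu, v1, v2, s1, s2, he⟩ := hb
  obtain ⟨q1, q2⟩ := step_rel hh s1
  obtain ⟨q3, q4⟩ := step_rel hh s2
  have hr : Rel h (m lam) (m tau) v1 v2 := by
    intro x hx
    have e1 := q2 x hx
    have e2 := q4 x hx
    unfold d; omega
  have ha : a ∈ ({v1, v2} : Multiset ℕ) := by rw [← he]; simp
  have hc : (a = v1 ∧ b = v2) ∨ (a = v2 ∧ b = v1) := by
    simp only [Multiset.insert_eq_cons, Multiset.mem_cons, Multiset.mem_singleton] at ha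
    rcases ha with rfl | rfl
    · left; refine ⟨rfl, ?_⟩
      simpa using he
    · right; refine ⟨rfl, ?_⟩
      rw [Multiset.pair_comm v1 a] at he
      simpa using he
  rcases hc with ⟨rfl, rfl⟩ | ⟨rfl, rfl⟩
  · exact ⟨q1, q3, hr⟩
  · exact ⟨q3, q1, hr.symm⟩

theorem rel_uniq_aux {n h : ℕ} (hh : h = 2 * n + 1) {L S : ℕ → ℕ} {a b a' b' : ℕ}
    (ha : n < a) (ha' : n < a') (hab : a ≤ b) (hab' : a' ≤ b') (hbb : b' ≤ b)
    (r1 : Rel h L S a b) (r2 : Rel h L S a' b') : a = a' ∧ b = b' := by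
  have hb : b = b' := by
    have e1 := r1 b (by omega)
    have e2 := r2 b (by omega)
    unfold d at e1 e2
    repeat rw [if_neg (show ¬ a = b + h by omega)] at e1
    repeat rw [if_neg (show ¬ b = b + h by omega)] at e1
    rw [if_pos rfl] at e1
    rw [if_neg (show ¬ a' = b + h by omega), if_neg (show ¬ b' = b + h by omega),
      if_neg (show ¬ a' + b = h by omega), if_neg (show ¬ b' + b = h by omega)] at e2
    by_contra hne
    rw [if_neg (show ¬ b' = b by omega), if_neg (show ¬ a' = b by omega)] at e2
    omega
  subst hb
  have e1 := r1 a (by omega)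
  have e2 := r2 a (by omega)
  have e3 := r1 a' (by omega)
  have e4 := r2 a' (by omega)
  refine ⟨?_, rfl⟩
  have k1 := d_cases a (a + h)
  have k2 := d_cases a a
  have k3 := d_cases (a + a) h
  have k4 := d_cases a' (a' + h)
  have k5 := d_cases a' a'
  have k6 := d_cases (a' + a') h
  have k7 := d_cases a' (a + h)
  have k8 := d_cases a' a
  have k9 := d_cases (a' + a) h
  have k10 := d_cases a (a' + h)
  have k11 := d_cases a a'
  have k12 := d_cases (a + a') h
  omega

theorem rel_uniq {n h : ℕ} (hh : h = 2 * n + 1) {L S : ℕ → ℕ} {a b a' b' : ℕ}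
    (ha : n < a) (ha' : n < a') (hb : n < b) (hb' : n < b')
    (r1 : Rel h L S a b) (r2 : Rel h L S a' b') : (a = a' ∧ b = b') ∨ (a = b' ∧ b = a') := by
  have aux : ∀ a b a' b', n < a → n < a' → a ≤ b → a' ≤ b' → Rel h L S a b → Rel h L S a' b' → a = a' ∧ b = b' := by
    intro a b a' b' g1 g2 g3 g4 g5 g6
    rcases le_total b' b with h1 | h1
    · exact rel_uniq_aux hh g1 g2 g3 g4 h1 g5 g6
    · have := rel_uniq_aux hh g2 g1 g4 g3 h1 g6 g5
      omega
  rcases le_total a b with h1 | h1 <;> rcases le_total a' b' with h2 | h2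
  · have := aux _ _ _ _ ha ha' h1 h2 r1 r2; omega
  · have := aux _ _ _ _ ha hb' h1 h2 r1 r2.symm; omega
  · have := aux _ _ _ _ hb ha' h1 h2 r1.symm r2; omega
  · have := aux _ _ _ _ hb hb' h1 h2 r1.symm r2.symm; omega

/-! legs -/

def pr (L S : ℕ → ℕ) (x : ℕ) : ℕ := if 1 ≤ L x ∧ 1 ≤ S x then 1 else 0

def G (p : ℕ → ℕ) (t : ℕ) : ℕ := ∑ x ∈ Finset.range t, p x

theorem G_succ (p : ℕ → ℕ) (t : ℕ) : G p (t + 1) = G p t + p t := Finset.sum_range_succ _ _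

theorem ncard_G (L S : ℕ → ℕ) (lo hi : ℕ) (hlt : lo < hi) (Q : ℕ → Prop)
    (hQ : ∀ x, Q x ↔ (1 ≤ L x ∧ 1 ≤ S x)) :
    Set.ncard {x : ℕ | lo < x ∧ x < hi ∧ Q x} + G (pr L S) (lo + 1) = G (pr L S) hi := by
  have hset : ∀ t, {x : ℕ | lo < x ∧ x < t ∧ Q x} =
      (((Finset.Ico (lo + 1) t).filter (fun x => 1 ≤ L x ∧ 1 ≤ S x) : Finset ℕ) : Set ℕ) := by
    intro t; ext x
    simp only [Set.mem_ofPred_eq, hQ, Finset.coe_filter, Finset.mem_Ico]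
    constructor
    · rintro ⟨h1, h2, h3⟩; exact ⟨⟨h1, h2⟩, h3⟩
    · rintro ⟨⟨h1, h2⟩, h3⟩; exact ⟨h1, h2, h3⟩
  rw [hset, Set.ncard_coe_finset, Finset.card_filter]
  unfold G pr
  rw [add_comm, Finset.sum_range_add_sum_Ico _ (show lo + 1 ≤ hi from hlt)]

theorem leg_big {h : ℕ} {tau lam : BPartition} {c : ℕ} (h0 : 0 < h) (hc : h ≤ c) :
    legLen h tau lam c + G (pr (m lam) (m tau)) (c - h + 1) = G (pr (m lam) (m tau)) c := by
  unfold legLen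
  rw [if_pos hc]
  exact ncard_G _ _ _ _ (by omega) _ (fun x => by rw [mem_iff_m, mem_iff_m])

theorem leg_small {n h : ℕ} {tau lam : BPartition} {c : ℕ} (hh : h = 2 * n + 1) (hn : n < c) (hc : c < h) :
    legLen h tau lam c + G (pr (m lam) (m tau)) (h - c + 1) = h - c + G (pr (m lam) (m tau)) c := by
  unfold legLen
  rw [if_neg (by omega)]
  have := ncard_G (m lam) (m tau) (h - c) c (by omega) (fun x => x ∈ partsM lam ∧ x ∈ partsM tau) (fun x => by rw [mem_iff_m, mem_iff_m])
  omega

/-! numeric facts for i ≥ 1 -/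

structure Num (n h i : ℕ) (L S : ℕ → ℕ) (a b : ℕ) : Prop where
  hn : 1 ≤ n
  hh : h = 2 * n + 1
  hi1 : 1 ≤ i
  hi : i ≤ n
  Lle : ∀ x, ¬ h ∣ x → L x ≤ 1
  Sle : ∀ x, ¬ h ∣ x → S x ≤ 1
  Sd : ∀ x, 1 ≤ x → 1 ≤ S (x + h) → 1 ≤ S x
  Sp : ∀ x y, x + y = h → 1 ≤ S x → 1 ≤ S y → False
  F : ∀ x, V h i x → 1 ≤ S (x + 1) → 1 ≤ S (x + h)
  G : 1 ≤ S i ∨ 1 ≤ S (h - 1 - i)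
  FL : ∀ x, V h i x → 1 ≤ L (x + 1) → 1 ≤ L x
  an : n < a
  bn : n < b
  rel : Rel h L S a b

theorem Num.symm {n h i : ℕ} {L S : ℕ → ℕ} {a b : ℕ} (N : Num n h i L S a b) : Num n h i L S b a :=
  { N with an := N.bn, bn := N.an, rel := N.rel.symm }

theorem Num.A1 {n h i : ℕ} {L S : ℕ → ℕ} {x b : ℕ} (N : Num n h i L S (x + h) b) (hV : V h i x) :
    S (x + h + 1) = 0 ∧ (L (x + 1) = 0 ∨ S (x + 1) = 0) := by
  obtain ⟨f1, f2, f3, f4, f5⟩ := V_facts N.hn N.hh N.hi1 N.hi hV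
  have hh := N.hh
  have hV1 := (V_add (h := h)).2 hV
  have hV2 := (V_add (h := h)).2 hV1
  obtain ⟨-, -, g3, g4, -⟩ := V_facts N.hn N.hh N.hi1 N.hi hV1
  obtain ⟨-, -, k3, k4, -⟩ := V_facts N.hn N.hh N.hi1 N.hi hV2
  have l1 := N.Lle _ f3
  have l2 := N.Lle _ g3
  have l3 := N.Lle _ k3
  have r1 := N.rel x f2
  have r2 := N.rel (x + h) (by omega)
  have r3 := N.rel (x + h + h) (by omega)
  have hbn := N.bn
  have q1 := d_cases (x + h) (x + h)
  have q2 := d_cases b (x + h)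
  have q3 := d_cases b (x + h + h)
  have q4 := d_cases b (x + h + h + h)
  have q5 := d_cases (x + h) (x + h + h)
  have q6 := d_cases (x + h) (x + h + h + h)
  have q7 := d_cases b x
  have q8 := d_cases (b + x) h
  have q9 := d_cases (x + h + x) h
  have q10 := d_cases (x + h) x
  have key : ¬ 1 ≤ S (x + h) ∨ (L x = 0 ∧ ¬ 1 ≤ S (x + h + h)) := by
    have := N.Sd x f2
    have l4 := N.Sle _ f3
    omega
  constructor
  · by_contra hcon
    have h1 := N.F _ hV1 (by omega)
    have h2 := N.Sd _ (by omega) h1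
    omega
  · by_contra hcon
    have h1 := N.F _ hV (by omega)
    have h2 := N.FL _ hV (by omega)
    omega

theorem Num.A2 {n h i : ℕ} {L S : ℕ → ℕ} {y b : ℕ} (N : Num n h i L S (y + h + 1) b) (hV : V h i y) :
    1 ≤ L (y + h) ∧ 1 ≤ S (y + h) ∧ 1 ≤ L y ∧ 1 ≤ S y := by
  obtain ⟨f1, f2, f3, f4, f5⟩ := V_facts N.hn N.hh N.hi1 N.hi hV
  have hh := N.hh
  have hn := N.hn
  have hV1 := (V_add (h := h)).2 hV
  have hV2 := (V_add (h := h)).2 hV1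
  obtain ⟨-, -, g3, g4, -⟩ := V_facts N.hn N.hh N.hi1 N.hi hV1
  obtain ⟨-, -, k3, k4, -⟩ := V_facts N.hn N.hh N.hi1 N.hi hV2
  have l1 := N.Lle _ f3
  have l2 := N.Lle _ g3
  have l4 := N.Lle _ f4
  have l5 := N.Lle _ g4
  have l3 := N.Lle _ k3
  have l6 := N.Lle _ k4
  have t1 := N.Sle _ f4
  have r1 := N.rel y f2
  have r2 := N.rel (y + h) (by omega)
  have r3 := N.rel (y + h + h) (by omega)
  have r4 := N.rel (y + 1) (by omega)
  have r5 := N.rel (y + h + 1) (by omega)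
  have r6 := N.rel (y + h + h + 1) (by omega)
  have hbn := N.bn
  have z : ∀ p q : ℕ, p ≠ q → d p q = 0 := fun p q hpq => if_neg hpq
  have o : ∀ p q : ℕ, p = q → d p q = 1 := fun p q hpq => if_pos hpq
  rw [z (y + h + 1) (y + h) (by omega), z (y + h + 1) y (by omega), z (y + h + 1 + y) h (by omega)] at r1
  rw [z (y + h + 1) (y + h + h) (by omega), z (y + h + 1) (y + h) (by omega), z (y + h + 1 + (y + h)) h (by omega),
     z (b + (y + h)) h (by omega)] at r2
  rw [z (y + h + 1) (y + h + h + h) (by omega), z (y + h + 1) (y + h + h) (by omega), z (y + h + 1 + (y + h + h)) h (by omega),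
     z (b + (y + h + h)) h (by omega)] at r3
  rw [o (y + h + 1) (y + 1 + h) (by omega), z (y + h + 1) (y + 1) (by omega), z (y + h + 1 + (y + 1)) h (by omega)] at r4
  rw [z (y + h + 1) (y + h + 1 + h) (by omega), o (y + h + 1) (y + h + 1) (by omega), z (y + h + 1 + (y + h + 1)) h (by omega),
     z (b + (y + h + 1)) h (by omega)] at r5
  rw [z (y + h + 1) (y + h + h + 1 + h) (by omega), z (y + h + 1) (y + h + h + 1) (by omega), z (y + h + 1 + (y + h + h + 1)) h (by omega),
     z (b + (y + h + h + 1)) h (by omega)] at r6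
  have e1 := N.F _ hV
  have e2 := N.F _ hV1
  have e3 := N.FL _ hV1
  have e4 := N.FL _ hV2
  have e5 := N.Sd y f2
  have e6 := N.Sd (y + h) (by omega)
  have e7 : 1 ≤ S (y + h + h + 1) → 1 ≤ S (y + h + 1) := fun hq => N.Sd (y + h + 1) (by omega) (by rw [show y + h + 1 + h = y + h + h + 1 by omega]; exact hq)
  -- b ≠ y + h + 1
  have hb1 : b ≠ y + h + 1 := by
    intro hb
    rw [o b (y + h + 1) hb, z b (y + h + 1 + h) (by omega)] at r5
    omega
  rw [z b (y + h + 1) hb1] at r5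
  rw [z b (y + 1 + h) (by omega)] at r4
  by_cases hs : 1 ≤ S (y + 1)
  · have s1 := e1 hs
    have s2 := e5 s1
    have hL : 1 ≤ L (y + h) := by
      by_cases hc : 1 ≤ L (y + h + 1)
      · exact e3 hc
      · have hb : b = y + h + 1 + h := by
          have := d_cases b (y + h + 1 + h); omega
        rw [z b (y + h + h) (by omega), z b (y + h) (by omega)] at r2
        omega
    refine ⟨hL, s1, ?_, s2⟩
    by_cases hby : b = y + h
    · rw [o b _ hby, z b (y + h + h) (by omega)] at r2; omega
    · rw [z b _ hby] at r1; omega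
  · have hb : b = y + 1 ∨ b + (y + 1) = h := by
      have := d_cases b (y + 1)
      have := d_cases (b + (y + 1)) h
      omega
    have hL1 : 1 ≤ L (y + h + 1) := by
      rw [z b (y + h + 1 + h) (by omega)] at r5; omega
    have hL := e3 hL1
    have hsy : 1 ≤ S (y + h) := by
      rw [z b (y + h + h) (by omega), z b (y + h) (by omega)] at r2; omega
    have hsy' := e5 hsy
    refine ⟨hL, hsy, ?_, hsy'⟩
    rw [z b (y + h) (by omega)] at r1
    omega

theorem Num.Gc {n h i : ℕ} {L S : ℕ → ℕ} {a b : ℕ} (N : Num n h i L S a b) {x y : ℕ} (hxy : x + y + 1 = h)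
    (hV : V h i x) : 1 ≤ S x ∨ 1 ≤ S y := by
  rw [V_small (by omega)] at hV
  have hi := N.hi
  rcases hV with h1 | h1
  · rw [h1, show y = h - 1 - i by omega]; exact N.G
  · rw [show y = i by omega, show x = h - 1 - i by omega]; exact N.G.symm

/-- c < h, V c ; y = h - c - 1 -/
theorem Num.A3 {n h i : ℕ} {L S : ℕ → ℕ} {c b y : ℕ} (N : Num n h i L S c b) (hV : V h i c) (hy : c + y + 1 = h) :
    S (c + 1) = 0 ∧ 1 ≤ L y ∧ 1 ≤ S y := by
  have hVy := V_neg hy hV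
  obtain ⟨f1, f2, f3, f4, f5⟩ := V_facts N.hn N.hh N.hi1 N.hi hV
  obtain ⟨g1, g2, g3, g4, g5⟩ := V_facts N.hn N.hh N.hi1 N.hi hVy
  have hh := N.hh
  have hn := N.hn
  have han := N.an
  have hbn := N.bn
  have hVc1 := (V_add (h := h)).2 hV
  have hVy1 := (V_add (h := h)).2 hVy
  obtain ⟨-, -, v3, v4, -⟩ := V_facts N.hn N.hh N.hi1 N.hi hVc1
  obtain ⟨-, -, w3, w4, -⟩ := V_facts N.hn N.hh N.hi1 N.hi hVy1
  have z : ∀ p q : ℕ, p ≠ q → d p q = 0 := fun p q hpq => if_neg hpq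
  have o : ∀ p q : ℕ, p = q → d p q = 1 := fun p q hpq => if_pos hpq
  have r1 := N.rel c f2
  have r2 := N.rel (c + h) (by omega)
  have r3 := N.rel (y + 1) (by omega)
  have r4 := N.rel y g2
  have r5 := N.rel (y + 1 + h) (by omega)
  have r6 := N.rel (y + h) (by omega)
  rw [z c (c + h) (by omega), o c c rfl, z (c + c) h (by omega)] at r1
  rw [z c (c + h + h) (by omega), z c (c + h) (by omega), z (c + (c + h)) h (by omega), z (b + (c + h)) h (by omega)] at r2
  rw [z c (y + 1 + h) (by omega), z c (y + 1) (by omega), o (c + (y + 1)) h (by omega)] at r3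
  rw [z c (y + h) (by omega), z c y (by omega), z (c + y) h (by omega)] at r4
  rw [z c (y + 1 + h + h) (by omega), z c (y + 1 + h) (by omega), z (c + (y + 1 + h)) h (by omega), z (b + (y + 1 + h)) h (by omega)] at r5
  rw [z c (y + h + h) (by omega), z c (y + h) (by omega), z (c + (y + h)) h (by omega), z (b + (y + h)) h (by omega)] at r6
  have l1 := N.Lle _ f3
  have l2 := N.Lle _ v3
  have l3 := N.Lle _ g4
  have l4 := N.Lle _ g3
  have l5 := N.Lle _ w3
  have l6 := N.Lle _ w4
  rw [show y + h + 1 = y + 1 + h by omega] at l6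
  have e1 := N.F _ hV
  have e2 := N.Sd c f2
  have e3 := N.FL _ hVy
  have e4 := N.FL _ hVy1
  rw [show y + h + 1 = y + 1 + h by omega] at e4
  have e5 := N.Sd y g2
  have p1 := N.Gc hy hV
  have hyi : y ≤ n := by
    have := (V_small (show c < h by omega)).1 hV
    have := N.hi
    omega
  have hbc : b ≠ c := by
    intro hb
    rw [o b c hb, z b (c + h) (by omega)] at r1
    omega
  rw [z b c hbc, z (b + c) h (by omega)] at r1
  have hsc : S (c + 1) = 0 := by
    by_contra hcon
    have h1 := e1 (by omega)
    have h2 := e2 h1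
    have h3 : b = c + h := by
      have := d_cases b (c + h); omega
    rw [z b (c + h + h) (by omega), o b (c + h) h3] at r2
    omega
  refine ⟨hsc, ?_⟩
  rw [z b (y + 1) (by omega), z (b + (y + 1)) h (by omega)] at r3
  by_cases hs : 1 ≤ S c
  · have h3 : b = c + h := by
      have := d_cases b (c + h); omega
    rw [z b (y + 1 + h) (by omega)] at r3
    have h4 := e3 (by omega)
    rw [z b (y + h) (by omega), z b y (by omega), z (b + y) h (by omega)] at r4
    omega
  · have h5 : 1 ≤ S y := by omega
    refine ⟨?_, h5⟩
    by_cases h6 : b = y + 1 + h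
    · rw [z b (y + h) (by omega)] at r4
      omega
    · rw [z b _ h6] at r3
      exact e3 (by omega)

/-- c < h, V (c-1), c = x + 1; y = h - c -/
theorem Num.A4 {n h i : ℕ} {L S : ℕ → ℕ} {x b y : ℕ} (N : Num n h i L S (x + 1) b) (hV : V h i x) (hy : x + 1 + y = h)
    (hx : n < x) : S (y + 1) = 0 ∧ 1 ≤ L x ∧ 1 ≤ S x := by
  have hVy := V_neg (show x + y + 1 = h by omega) hV
  obtain ⟨f1, f2, f3, f4, f5⟩ := V_facts N.hn N.hh N.hi1 N.hi hV
  obtain ⟨g1, g2, g3, g4, g5⟩ := V_facts N.hn N.hh N.hi1 N.hi hVy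
  have hh := N.hh
  have hbn := N.bn
  have z : ∀ p q : ℕ, p ≠ q → d p q = 0 := fun p q hpq => if_neg hpq
  have o : ∀ p q : ℕ, p = q → d p q = 1 := fun p q hpq => if_pos hpq
  have r1 := N.rel y g2
  have r2 := N.rel (x + 1) (by omega)
  have r3 := N.rel x f2
  rw [z (x + 1) (y + h) (by omega), z (x + 1) y (by omega), o (x + 1 + y) h (by omega)] at r1
  rw [z (x + 1) (x + 1 + h) (by omega), o (x + 1) (x + 1) rfl, z (x + 1 + (x + 1)) h (by omega), z (b + (x + 1)) h (by omega)] at r2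
  rw [z (x + 1) (x + h) (by omega), z (x + 1) x (by omega), z (x + 1 + x) h (by omega), z (b + x) h (by omega)] at r3
  have l1 := N.Lle _ f4
  have l2 := N.Lle _ f3
  have l3 := N.Lle _ g3
  have e1 := N.FL _ hV
  have p1 := N.Gc (show x + y + 1 = h by omega) hV
  have hbx : b ≠ x + 1 := by
    intro hb
    rw [o b _ hb, z b (x + 1 + h) (by omega)] at r2
    omega
  rw [z b _ hbx] at r2
  have key : 1 ≤ L x ∧ 1 ≤ S x := by
    by_cases hs : 1 ≤ S y
    · have hb : b = y + h := by
        have := d_cases b (y + h); omega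
      rw [z b (x + 1 + h) (by omega)] at r2
      have := e1 (by omega)
      rw [z b (x + h) (by omega), z b x (by omega)] at r3
      omega
    · have h5 : 1 ≤ S x := by omega
      refine ⟨?_, h5⟩
      by_cases h6 : b = x + 1 + h
      · rw [z b (x + h) (by omega)] at r3
        omega
      · rw [z b _ h6] at r2
        exact e1 (by omega)
  refine ⟨?_, key⟩
  by_contra hcon
  exact N.Sp x (y + 1) (by omega) key.2 (by omega)

end BPartition

namespace BPartition

theorem G_tr {h i : ℕ} {p p' : ℕ → ℕ} (h0 : ¬ V h i 0) (hVs : ∀ x, V h i x → ¬ V h i (x + 1))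
    (hp1 : ∀ x, V h i x → p' x = p (x + 1) ∧ p' (x + 1) = p x)
    (hp2 : ∀ x, ¬ V h i x → ¬ V h i (x - 1) → p' x = p x) (t : ℕ) :
    (¬ V h i t → G p' (t + 1) = G p (t + 1)) ∧ (V h i t → G p' (t + 1) + p t = G p (t + 1) + p (t + 1)) := by
  induction t with
  | zero =>
    refine ⟨fun _ => ?_, fun hc => absurd hc h0⟩
    rw [G_succ, G_succ, hp2 0 h0 h0]; rfl
  | succ t ih =>
    rw [G_succ p' (t + 1), G_succ p (t + 1)]
    by_cases hV : V h i t
    · have e := ih.2 hV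
      have e2 := (hp1 t hV).2
      refine ⟨fun _ => by omega, fun hc => absurd hc (hVs t hV)⟩
    · have e := ih.1 hV
      constructor
      · intro h1
        rw [hp2 (t + 1) h1 hV, e]
      · intro h1
        rw [(hp1 _ h1).1]; omega

theorem d_congr {p q r s : ℕ} (hi : p = q ↔ r = s) : d p q = d r s := by
  unfold d; simp only [hi]

open Classical in
/-- action on parts -/
noncomputable def sw (h i x : ℕ) : ℕ := if V h i x then x + 1 else if V h i (x - 1) then x - 1 else x

open Classical in
/-- action on bar positions -/
noncomputable def st (n h i c : ℕ) : ℕ :=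
  if V h i c then c + 1 else if V h i (c - 1) ∧ c ≠ n + 1 then c - 1 else c

section
variable {n h i : ℕ} (hn : 1 ≤ n) (hh : h = 2 * n + 1) (hi1 : 1 ≤ i) (hi : i ≤ n)

open Classical in
noncomputable def vv (h i x : ℕ) : ℕ := if V h i x then 1 else 0

theorem vv_one {x : ℕ} : V h i x ↔ vv h i x = 1 := by
  unfold vv; split_ifs <;> simp_all

theorem vv_le {x : ℕ} : vv h i x ≤ 1 := by
  unfold vv; split_ifs <;> omega

theorem vv_congr {x y : ℕ} (hxy : V h i x ↔ V h i y) : vv h i x = vv h i y := by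
  by_cases hV : V h i y
  · simp [vv, hV, hxy.2 hV]
  · have : ¬ V h i x := fun q => hV (hxy.1 q)
    simp [vv, hV, this]

theorem vv_zero {x : ℕ} : ¬ V h i x ↔ vv h i x = 0 := by
  unfold vv; split_ifs <;> simp_all

theorem st_cases (c : ℕ) : (vv h i c = 1 ∧ st n h i c = c + 1) ∨ (vv h i c = 0 ∧ vv h i (c - 1) = 1 ∧ c ≠ n + 1 ∧ st n h i c = c - 1) ∨
    (vv h i c = 0 ∧ c = n + 1 ∧ vv h i (c - 1) = 1 ∧ st n h i c = c) ∨ (vv h i c = 0 ∧ vv h i (c - 1) = 0 ∧ st n h i c = c) := by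
  simp only [← vv_one, ← vv_zero]
  unfold st; split_ifs <;> tauto

theorem sw_cases (c : ℕ) : (vv h i c = 1 ∧ sw h i c = c + 1) ∨ (vv h i c = 0 ∧ vv h i (c - 1) = 1 ∧ sw h i c = c - 1) ∨
    (vv h i c = 0 ∧ vv h i (c - 1) = 0 ∧ sw h i c = c) := by
  simp only [← vv_one, ← vv_zero]
  unfold sw; split_ifs <;> tauto

include hn hh hi1 hi in
theorem vv_pred (x : ℕ) : (vv h i x = 1 → vv h i (x - 1) = 0) ∧ (vv h i (x - 1) = 1 → 2 ≤ x) ∧ vv h i x ≤ 1 := by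
  refine ⟨?_, ?_, vv_le⟩
  · rw [← vv_one, ← vv_zero]; exact fun q => (V_facts hn hh hi1 hi q).2.2.2.2
  · rw [← vv_one]; intro q
    have := (V_facts hn hh hi1 hi q).2.1; omega

include hn hh hi1 hi in
theorem st_big {c x : ℕ} (hc : n < c) (hx : 1 ≤ x) : d (st n h i c) (x + h) = d c (sw h i x + h) := by
  apply d_congr
  have a1 : c = x + h + 1 → vv h i (c - 1) = vv h i x := by
    rintro rfl; exact vv_congr V_add
  have a2 : c + 1 = x + h → vv h i (x - 1) = vv h i c := by
    intro q; rw [show c = x - 1 + h by omega]; exact (vv_congr V_add).symm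
  have a5 : c = x + h → vv h i c = vv h i x := by
    rintro rfl; exact vv_congr V_add
  have a6 : c = x + h → vv h i (c - 1) = vv h i (x - 1) := by
    rintro rfl; rw [show x + h - 1 = x - 1 + h by omega]; exact vv_congr V_add
  have p1 := vv_pred hn hh hi1 hi x
  have p2 := vv_pred hn hh hi1 hi c
  have q1 := st_cases (n := n) (h := h) (i := i) c
  have q2 := sw_cases (h := h) (i := i) x
  omega

include hn hh hi1 hi in
theorem st_small {c x : ℕ} (hc : n < c) (hx : 1 ≤ x) :
    d (st n h i c) x + d (st n h i c + x) h = d c (sw h i x) + d (c + sw h i x) h := by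
  have b1 : c = x → vv h i c = vv h i x ∧ vv h i (c - 1) = vv h i (x - 1) := by
    rintro rfl; exact ⟨rfl, rfl⟩
  have b2 : c = x + 1 → vv h i (c - 1) = vv h i x := by rintro rfl; rfl
  have b3 : x = c + 1 → vv h i (x - 1) = vv h i c := by rintro rfl; rfl
  have b4 : c + x = h → vv h i c = vv h i (x - 1) ∧ vv h i (c - 1) = vv h i x := by
    intro q
    exact ⟨vv_congr ⟨V_neg (by omega), V_neg (by omega)⟩, vv_congr ⟨V_neg (by omega), V_neg (by omega)⟩⟩
  have b5 : c + x + 1 = h → vv h i c = vv h i x := by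
    intro q
    exact vv_congr ⟨V_neg (by omega), V_neg (by omega)⟩
  have b6 : c + x = h + 1 → vv h i (c - 1) = vv h i (x - 1) := by
    intro q
    exact vv_congr ⟨V_neg (by omega), V_neg (by omega)⟩
  have p1 := vv_pred hn hh hi1 hi x
  have p2 := vv_pred hn hh hi1 hi c
  have e1 := d_cases (st n h i c) x
  have e2 := d_cases (st n h i c + x) h
  have e3 := d_cases c (sw h i x)
  have e4 := d_cases (c + sw h i x) h
  have q1 := st_cases (n := n) (h := h) (i := i) c
  have q2 := sw_cases (h := h) (i := i) x
  rcases q1 with q1 | q1 | q1 | q1 <;> rcases q2 with q2 | q2 | q2 <;> omega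

end
end BPartition

namespace BPartition

structure Tr (h i : ℕ) (f f' : ℕ → ℕ) : Prop where
  t1 : ∀ x, V h i x → f' x = f (x + 1) ∧ f' (x + 1) = f x
  t2 : ∀ x, ¬ V h i x → ¬ V h i (x - 1) → f' x = f x

theorem Tr.pr {h i : ℕ} {L S L' S' : ℕ → ℕ} (T : Tr h i L L') (T' : Tr h i S S') :
    Tr h i (pr L S) (pr L' S') := by
  constructor
  · intro x hV
    unfold BPartition.pr
    rw [(T.t1 x hV).1, (T.t1 x hV).2, (T'.t1 x hV).1, (T'.t1 x hV).2]
    exact ⟨rfl, rfl⟩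
  · intro x h1 h2
    unfold BPartition.pr
    rw [T.t2 x h1 h2, T'.t2 x h1 h2]

theorem Tr.sw {h i : ℕ} {f f' : ℕ → ℕ} (T : Tr h i f f') {x : ℕ} (hx : 1 ≤ x) : f' x = f (sw h i x) := by
  rcases sw_cases (h := h) (i := i) x with ⟨k1, k2⟩ | ⟨k1, k3, k2⟩ | ⟨k1, k3, k2⟩ <;> rw [k2]
  · exact (T.t1 x (vv_one.2 k1)).1
  · have := (T.t1 _ (vv_one.2 k3)).2
    rwa [show x - 1 + 1 = x by omega] at this
  · exact T.t2 x (vv_zero.2 k1) (vv_zero.2 k3)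

theorem pr_one {L S : ℕ → ℕ} {x : ℕ} (h1 : 1 ≤ L x) (h2 : 1 ≤ S x) : pr L S x = 1 := by
  unfold pr; rw [if_pos ⟨h1, h2⟩]

theorem pr_zero {L S : ℕ → ℕ} {x : ℕ} (h1 : L x = 0 ∨ S x = 0) : pr L S x = 0 := by
  unfold pr; rw [if_neg (by omega)]

theorem rel_st {n h i : ℕ} {L S L' S' : ℕ → ℕ} {a b : ℕ} (N : Num n h i L S a b) (T : Tr h i L L')
    (T' : Tr h i S S') : Rel h L' S' (st n h i a) (st n h i b) := by
  intro x hx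
  have hsx : 1 ≤ sw h i x := by
    have p1 := vv_pred N.hn N.hh N.hi1 N.hi x
    have := sw_cases (h := h) (i := i) x
    omega
  have r := N.rel (sw h i x) hsx
  rw [T.sw hx, T'.sw hx]
  have e1 := st_big N.hn N.hh N.hi1 N.hi N.an hx
  have e2 := st_big N.hn N.hh N.hi1 N.hi N.bn hx
  have e3 := st_small N.hn N.hh N.hi1 N.hi N.an hx
  have e4 := st_small N.hn N.hh N.hi1 N.hi N.bn hx
  omega

theorem st_gt {n h i : ℕ} {L S : ℕ → ℕ} {a b : ℕ} (N : Num n h i L S a b) : n < st n h i a := by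
  have := N.an
  have := st_cases (n := n) (h := h) (i := i) a
  omega

theorem legs1 {n h i : ℕ} {lam sg lam' tau : BPartition} {c b : ℕ} (N : Num n h i (m lam) (m sg) c b)
    (T : Tr h i (m lam) (m lam')) (T' : Tr h i (m sg) (m tau)) :
    legLen h tau lam' (st n h i c) = legLen h sg lam c := by
  have TP := T.pr T'
  have hn := N.hn
  have hh := N.hh
  have hi1 := N.hi1
  have hi := N.hi
  have hc := N.an
  have h0 : ¬ V h i 0 := fun q => by have := (V_facts N.hn N.hh N.hi1 N.hi q).2.1; omega
  have g := G_tr h0 (fun x q => (V_facts N.hn N.hh N.hi1 N.hi q).1) TP.t1 TP.t2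
  set P := pr (m lam) (m sg) with hP
  set P' := pr (m lam') (m tau) with hP'
  have gs := G_succ P
  have gs' := G_succ P'
  rcases st_cases (n := n) (h := h) (i := i) c with ⟨g1, g2⟩ | ⟨g1, g3, g4, g2⟩ | ⟨g1, g4, g3, g2⟩ | ⟨g1, g3, g2⟩ <;>
    rw [g2]
  · have hV := vv_one.2 g1
    have f := V_facts hn hh hi1 hi hV
    obtain ⟨-, f2, f3, f4, f5⟩ := f
    by_cases hch : h ≤ c
    · obtain ⟨x, rfl⟩ : ∃ x, c = x + h := ⟨c - h, by omega⟩
      have hVx := V_add.1 hV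
      obtain ⟨A, B⟩ := N.A1 hVx
      have e1 := leg_big (tau := tau) (lam := lam') (show 0 < h by omega) (show h ≤ x + h + 1 by omega)
      have e2 := leg_big (tau := sg) (lam := lam) (show 0 < h by omega) hch
      rw [← hP'] at e1
      rw [← hP] at e2
      rw [show x + h + 1 - h + 1 = x + 1 + 1 by omega] at e1
      rw [show x + h - h + 1 = x + 1 by omega] at e2
      have k1 := (g (x + h)).2 hV
      have k2 := (g x).2 hVx
      have k3 := gs' (x + 1)
      have k4 := (TP.t1 x hVx).2
      have k5 := gs (x + h)
      have z1 : P (x + h + 1) = 0 := pr_zero (Or.inr A)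
      have z2 : P (x + 1) = 0 := pr_zero B
      omega
    · obtain ⟨y, hy⟩ : ∃ y, c + y + 1 = h := ⟨h - c - 1, by omega⟩
      have hy0 : y ≠ 0 := by rintro rfl; exact f4 ⟨1, by omega⟩
      have hVy := V_neg hy hV
      obtain ⟨A, B, D⟩ := N.A3 hV hy
      have e1 := leg_small (tau := tau) (lam := lam') hh (show n < c + 1 by omega) (show c + 1 < h by omega)
      have e2 := leg_small (tau := sg) (lam := lam) hh hc (by omega)
      rw [← hP'] at e1
      rw [← hP] at e2
      rw [show h - (c + 1) = y by omega] at e1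
      rw [show h - c = y + 1 by omega] at e2
      have k1 := (g c).2 hV
      have k2 := (g y).2 hVy
      have k3 := gs (y + 1)
      have k5 := gs c
      have z1 : P (c + 1) = 0 := pr_zero (Or.inr A)
      have z2 : P y = 1 := pr_one B D
      omega
  · have hV := vv_one.2 g3
    have f := V_facts hn hh hi1 hi hV
    obtain ⟨-, f2, f3, f4, f5⟩ := f
    obtain ⟨x, rfl⟩ : ∃ x, c = x + 1 := ⟨c - 1, by omega⟩
    simp only [Nat.add_sub_cancel] at *
    by_cases hch : h ≤ x
    · obtain ⟨y, rfl⟩ : ∃ y, x = y + h := ⟨x - h, by omega⟩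
      have hVy := V_add.1 hV
      have hy1 := (V_facts hn hh hi1 hi hVy).2.1
      obtain ⟨A1, A2, A3, A4⟩ := N.A2 hVy
      have e1 := leg_big (tau := tau) (lam := lam') (show 0 < h by omega) hch
      have e2 := leg_big (tau := sg) (lam := lam) (show 0 < h by omega) (show h ≤ y + h + 1 by omega)
      rw [← hP'] at e1
      rw [← hP] at e2
      rw [show y + h - h + 1 = y + 1 by omega] at e1
      rw [show y + h + 1 - h + 1 = y + 1 + 1 by omega] at e2
      have k1 := (g (y + h)).2 hV
      have k2 := (g y).2 hVy
      have k3 := gs (y + 1)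
      have k4 := (TP.t1 (y + h) hV).1
      have k5 := gs' (y + h)
      have z1 : P (y + h) = 1 := pr_one A1 A2
      have z2 : P y = 1 := pr_one A3 A4
      omega
    · have hx1 : x + 1 ≠ h := fun q => f4 ⟨1, by omega⟩
      obtain ⟨y, hy⟩ : ∃ y, x + 1 + y = h := ⟨h - (x + 1), by omega⟩
      have hVy := V_neg (show x + y + 1 = h by omega) hV
      obtain ⟨A, B, D⟩ := N.A4 hV hy (by omega)
      have e1 := leg_small (tau := tau) (lam := lam') hh (show n < x by omega) (show x < h by omega)
      have e2 := leg_small (tau := sg) (lam := lam) hh hc (by omega)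
      rw [← hP'] at e1
      rw [← hP] at e2
      rw [show h - x = y + 1 by omega] at e1
      rw [show h - (x + 1) = y by omega] at e2
      have k1 := (g x).2 hV
      have k2 := (g y).2 hVy
      have k3 := gs' (y + 1)
      have k4 := (TP.t1 y hVy).2
      have k5 := gs' x
      have k6 := (TP.t1 x hV).1
      have z1 : P (y + 1) = 0 := pr_zero (Or.inr A)
      have z2 : P x = 1 := pr_one B D
      omega
  · subst g4
    have e1 := leg_small (tau := tau) (lam := lam') hh (show n < n + 1 by omega) (show n + 1 < h by omega)
    have e2 := leg_small (tau := sg) (lam := lam) hh (show n < n + 1 by omega) (show n + 1 < h by omega)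
    rw [show h - (n + 1) = n by omega] at e1 e2
    omega
  · have hV := vv_zero.2 g3
    have hV1 := vv_zero.2 g1
    obtain ⟨x, rfl⟩ : ∃ x, c = x + 1 := ⟨c - 1, by omega⟩
    simp only [Nat.add_sub_cancel] at *
    have k1 := (g x).1 hV
    by_cases hch : h ≤ x + 1
    · have e1 := leg_big (tau := tau) (lam := lam') (show 0 < h by omega) hch
      have e2 := leg_big (tau := sg) (lam := lam) (show 0 < h by omega) hch
      rw [← hP'] at e1
      rw [← hP] at e2
      have hw : ¬ V h i (x + 1 - h) := by
        intro q
        have := V_add.2 q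
        rw [show x + 1 - h + h = x + 1 by omega] at this
        exact hV1 this
      have k2 := (g (x + 1 - h)).1 hw
      omega
    · have e1 := leg_small (tau := tau) (lam := lam') hh hc (by omega)
      have e2 := leg_small (tau := sg) (lam := lam) hh hc (by omega)
      rw [← hP'] at e1
      rw [← hP] at e2
      have hw : ¬ V h i (h - (x + 1)) := fun q => hV (V_neg (by omega) q)
      have k2 := (g (h - (x + 1))).1 hw
      omega

theorem case1 {n h i : ℕ} (hn : 1 ≤ n) (hh : h = 2 * n + 1) (hi1 : 1 ≤ i) (hi : i ≤ n) {sg lam : BPartition}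
    (hc : IsBarCore h sg) (hadd : ∃ y, Addable h i sg y) (hs : IsHStrict h lam)
    (hunex : ∀ x, ¬ Removable h i lam x)
    {a b a' b' : ℕ} (hab : BarPositions h sg lam a b)
    (hab' : BarPositions h (psi h i sg) (psi h i lam) a' b') :
    ddd h (psi h i sg) (psi h i lam) a' b' = ddd h sg lam a b := by
  obtain ⟨c1, c2, c3⟩ := core_facts hh hc
  obtain ⟨s1, s2, s3⟩ := sigma_facts1 hn hh hi1 hi hc hadd
  obtain ⟨u1, u2, -⟩ := psi_m1 hn hh hi1 hi hc.1 s3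
  obtain ⟨w1, w2, w3⟩ := psi_m1 hn hh hi1 hi hs hunex
  obtain ⟨x1, x2, x3⟩ := rel_of_bar hh hab
  obtain ⟨y1, y2, y3⟩ := rel_of_bar hh hab'
  have N : Num n h i (m lam) (m sg) a b :=
    ⟨hn, hh, hi1, hi, fun x hx => m_le_one hs hx, fun x hx => m_le_one hc.1 hx, c2, c3, s1, s2, w3, x1, x2, x3⟩
  have T : Tr h i (m lam) (m (psi h i lam)) := ⟨w1, w2⟩
  have T' : Tr h i (m sg) (m (psi h i sg)) := ⟨u1, u2⟩
  have l1 := legs1 N T T'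
  have l2 := legs1 N.symm T T'
  have r := rel_st N T T'
  unfold ddd
  rcases rel_uniq hh (st_gt N) y1 (st_gt N.symm) y2 r y3 with ⟨rfl, rfl⟩ | ⟨rfl, rfl⟩
  · rw [l1, l2]
  · rw [l1, l2, max_comm, min_comm]

end BPartition

namespace BPartition

/-- unexceptional data for residue 0 -/
structure Un (h : ℕ) (L L' : ℕ → ℕ) : Prop where
  u1 : ∀ y, h ∣ y + 1 → L' y = 0 ∧ L' (y + 1) = L (y + 1) ∧ L' (y + 2) = L y ∧ L (y + 2) = 0 ∧ (1 ≤ L (y + 1) → 1 ≤ L y)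
  u2 : ∀ x, x % h ≠ 0 → x % h ≠ 1 → x % h + 1 ≠ h → L' x = L x
  u3 : L' 1 = 1
  u4 : L 1 = 0

structure N0 (n h : ℕ) (L S L' S' : ℕ → ℕ) (a b : ℕ) : Prop where
  hn : 1 ≤ n
  hh : h = 2 * n + 1
  UL : Un h L L'
  US : Un h S S'
  S0 : ∀ x, h ∣ x → S x = 0
  S0' : S' 0 = 0
  Sd : ∀ x, 1 ≤ x → 1 ≤ S (x + h) → 1 ≤ S x
  Sh : 1 ≤ S (h - 1)
  an : n < a
  bn : n < b
  rel : Rel h L S a b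

theorem N0.symm {n h : ℕ} {L S L' S' : ℕ → ℕ} {a b : ℕ} (N : N0 n h L S L' S' a b) : N0 n h L S L' S' b a :=
  { N with an := N.bn, bn := N.an, rel := N.rel.symm }

theorem N0.c1 {n h : ℕ} {L S L' S' : ℕ → ℕ} {a b : ℕ} (N : N0 n h L S L' S' a b) : a % h ≠ 1 := by
  intro hm
  have hn := N.hn
  have hh := N.hh
  have han := N.an
  obtain ⟨y, rfl⟩ : ∃ y, a = y + 2 := ⟨a - 2, by omega⟩
  have hd : h ∣ y + 1 := by
    have := (Nat.modEq_iff_dvd' (show 1 ≤ y + 2 by omega)).1 (show 1 ≡ y + 2 [MOD h] by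
      unfold Nat.ModEq; rw [hm, Nat.mod_eq_of_lt (by omega)])
    exact this
  have hd2 : h ∣ y + h + 1 := by
    rw [show y + h + 1 = y + 1 + h by omega]; exact Nat.dvd_add_self_right.2 hd
  have q1 := (N.UL.u1 y hd).2.2.2.1
  have q2 := (N.UL.u1 _ hd2).2.2.2.1
  have r1 := N.rel (y + 2) (by omega)
  have r2 := N.rel (y + h + 2) (by omega)
  have := d_cases (y + 2) (y + 2 + h)
  have := d_cases (y + 2) (y + 2)
  have := d_cases b (y + 2 + h)
  have := d_cases (y + 2) (y + h + 2 + h)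
  have := d_cases b (y + h + 2 + h)
  have := d_cases b (y + h + 2)
  omega

theorem N0.c2 {n h : ℕ} {L S L' S' : ℕ → ℕ} {a b : ℕ} (N : N0 n h L S L' S' a b) : a ≠ h - 1 := by
  intro hm
  have hn := N.hn
  have hh := N.hh
  have r := N.rel 1 le_rfl
  have h1 := N.c1
  have h2 := N.symm.c1
  have u := N.UL.u4
  have e : (1 + h) % h = 1 := by rw [Nat.add_mod_right, Nat.mod_eq_of_lt (by omega)]
  have := d_cases (a + 1) h
  rcases d_cases a (1 + h) with q | q | q
  · rw [q.1] at h1; exact h1 e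
  all_goals
    rcases d_cases b (1 + h) with q' | q' | q'
    · rw [q'.1] at h2; exact h2 e
    all_goals omega

def st0 (h c : ℕ) : ℕ := if c % h + 1 = h then c + 2 else c

theorem mod_m1 {n h y : ℕ} (hn : 1 ≤ n) (hh : h = 2 * n + 1) (hd : h ∣ y + 1) :
    y % h + 1 = h ∧ (y + 1) % h = 0 ∧ (y + 2) % h = 1 ∧ h ≤ y + 1 := by
  have e1 := succ_mod (show 2 ≤ h by omega) y
  have e2 := succ_mod (show 2 ≤ h by omega) (y + 1)
  have e3 := Nat.mod_eq_zero_of_dvd hd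
  have e4 := Nat.le_of_dvd (by omega) hd
  rw [show y + 1 + 1 = y + 2 by omega] at e2
  omega

theorem dvd_m1 {n h y : ℕ} (hn : 1 ≤ n) (hh : h = 2 * n + 1) (hm : y % h + 1 = h) : h ∣ y + 1 := by
  have e1 := succ_mod (show 2 ≤ h by omega) y
  exact Nat.dvd_of_mod_eq_zero (by omega)

section
variable {n h c : ℕ} (hn : 1 ≤ n) (hh : h = 2 * n + 1) (hc : n < c) (hc1 : c % h ≠ 1) (hc2 : c ≠ h - 1)

include hn hh hc hc2 in
theorem st0_cases : (c % h + 1 = h ∧ st0 h c = c + 2 ∧ st0 h c % h = 1 ∧ h < c) ∨ (c % h + 1 ≠ h ∧ st0 h c = c) := by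
  unfold st0
  split_ifs with hm
  · left
    have := mod_m1 hn hh (dvd_m1 hn hh hm)
    refine ⟨hm, rfl, this.2.2.1, ?_⟩
    by_contra hlt
    rcases Nat.lt_or_ge c h with h1 | h1
    · rw [Nat.mod_eq_of_lt h1] at hm; omega
    · have : c = h := by omega
      rw [this, Nat.mod_self] at hm; omega
  · exact Or.inr ⟨hm, rfl⟩

include hn hh hc hc1 hc2 in
theorem st0_o {x : ℕ} (hx1 : x % h ≠ 1) (hx2 : x % h + 1 ≠ h) :
    d (st0 h c) (x + h) = d c (x + h) ∧ d (st0 h c) x = d c x ∧ d (st0 h c + x) h = d (c + x) h := by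
  have q := st0_cases hn hh hc hc2
  have e : (x + h) % h = x % h := Nat.add_mod_right _ _
  have k1 : st0 h c = x + h → st0 h c % h = x % h := fun q => by rw [q, e]
  have k2 : st0 h c = x → st0 h c % h = x % h := fun q => by rw [q]
  have k3 : c = x + h → c % h = x % h := fun q => by rw [q, e]
  have k4 : c = x → c % h = x % h := fun q => by rw [q]
  refine ⟨d_congr ?_, d_congr ?_, d_congr ?_⟩ <;> omega

include hn hh hc hc1 hc2 in
theorem st0_y {y : ℕ} (hd : h ∣ y + 1) :
    d (st0 h c) (y + h) = 0 ∧ d (st0 h c) y = 0 ∧ d (st0 h c + y) h = 0 ∧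
    d (st0 h c) (y + 2 + h) = d c (y + h) ∧ d (st0 h c) (y + 2) = d c y ∧ d (st0 h c + (y + 2)) h = 0 ∧
    d (c + y) h = 0 := by
  have q := st0_cases hn hh hc hc2
  obtain ⟨m1, m2, m3, m4⟩ := mod_m1 hn hh hd
  have e : (y + h) % h = y % h := Nat.add_mod_right _ _
  have e' : (y + 2 + h) % h = (y + 2) % h := Nat.add_mod_right _ _
  have k1 : st0 h c = y + h → st0 h c % h = y % h := fun q => by rw [q, e]
  have k2 : st0 h c = y → st0 h c % h = y % h := fun q => by rw [q]
  have k3 : c = y + h → c % h = y % h := fun q => by rw [q, e]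
  have k4 : c = y → c % h = y % h := fun q => by rw [q]
  have k5 : st0 h c = y + 2 + h → st0 h c % h = (y + 2) % h := fun q => by rw [q, e']
  have k7 : st0 h c = c → st0 h c % h = c % h := fun q => by rw [q]
  have k6 : st0 h c = y + 2 → st0 h c % h = (y + 2) % h := fun q => by rw [q]
  refine ⟨if_neg ?_, if_neg ?_, if_neg ?_, d_congr ?_, d_congr ?_, if_neg ?_, if_neg ?_⟩ <;> omega

include hn hh hc hc1 hc2 in
theorem st0_1 : d (st0 h c) (1 + h) = 0 ∧ d (st0 h c) 1 = 0 ∧ d (st0 h c + 1) h = 0 := by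
  have q := st0_cases hn hh hc hc2
  have e : (1 + h) % h = 1 := by rw [Nat.add_mod_right, Nat.mod_eq_of_lt (by omega)]
  have k3 : c = 1 + h → c % h = 1 := fun q => by rw [q, e]
  refine ⟨if_neg ?_, if_neg ?_, if_neg ?_⟩ <;> omega
end

theorem N0.relst {n h : ℕ} {L S L' S' : ℕ → ℕ} {a b : ℕ} (N : N0 n h L S L' S' a b) :
    Rel h L' S' (st0 h a) (st0 h b) := by
  intro x hx
  have hn := N.hn
  have hh := N.hh
  have a1 := N.c1
  have a2 := N.c2
  have b1 := N.symm.c1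
  have b2 := N.symm.c2
  by_cases hm : x % h + 1 = h
  · have hd := dvd_m1 hn hh hm
    have e1 := st0_y hn hh N.an a1 a2 hd
    have e2 := st0_y hn hh N.bn b1 b2 hd
    have := N.UL.u1 x hd
    have := N.US.u1 x hd
    omega
  by_cases hm1 : x % h = 1
  · by_cases hx1 : x = 1
    · subst hx1
      have e1 := st0_1 hn hh N.an a1 a2
      have e2 := st0_1 hn hh N.bn b1 b2
      have := N.UL.u3
      have := N.US.u3
      omega
    · obtain ⟨y, rfl⟩ : ∃ y, x = y + 2 := ⟨x - 2, by omega⟩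
      have hd : h ∣ y + 1 := by
        have := (Nat.modEq_iff_dvd' (show 1 ≤ y + 2 by omega)).1 (show 1 ≡ y + 2 [MOD h] by
          unfold Nat.ModEq; rw [hm1, Nat.mod_eq_of_lt (by omega)])
        exact this
      have e1 := st0_y hn hh N.an a1 a2 hd
      have e2 := st0_y hn hh N.bn b1 b2 hd
      have := N.UL.u1 y hd
      have := N.US.u1 y hd
      have hy := mod_m1 hn hh hd
      have r := N.rel y (by omega)
      omega
  have e1 := st0_o hn hh N.an a1 a2 hm1 hm
  have e2 := st0_o hn hh N.bn b1 b2 hm1 hm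
  have r := N.rel x hx
  have hLS : L' x = L x ∧ S' x = S x := by
    by_cases hm0 : x % h = 0
    · obtain ⟨y, rfl⟩ : ∃ y, x = y + 1 := ⟨x - 1, by omega⟩
      have hd := Nat.dvd_of_mod_eq_zero hm0
      exact ⟨(N.UL.u1 y hd).2.1, (N.US.u1 y hd).2.1⟩
    · exact ⟨N.UL.u2 x hm0 hm1 hm, N.US.u2 x hm0 hm1 hm⟩
  omega

theorem st0_gt {n h c : ℕ} (hc : n < c) : n < st0 h c := by
  unfold st0; split_ifs <;> omega

/-- transform of prefix sums -/
theorem G_tr0 {n h : ℕ} (hn : 1 ≤ n) (hh : h = 2 * n + 1) {p p' : ℕ → ℕ}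
    (p0 : p 0 = 0) (p0' : p' 0 = 0) (p1 : p 1 = 0) (p1' : p' 1 = 1)
    (hy : ∀ y, h ∣ y + 1 → p' y = 0 ∧ p' (y + 1) = 0 ∧ p' (y + 2) = p y ∧ p (y + 1) = 0 ∧ p (y + 2) = 0)
    (ho : ∀ x, x % h ≠ 0 → x % h ≠ 1 → x % h + 1 ≠ h → p' x = p x) (s : ℕ) :
    ((s + 2) % h ≠ 0 → (s + 2) % h ≠ 1 → G p' (s + 2) = G p (s + 2) + 1) ∧
    ((s + 2) % h = 0 → G p' (s + 2) + p (s + 1) = G p (s + 2) + 1) ∧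
    ((s + 2) % h = 1 → G p' (s + 2) + p s = G p (s + 2) + 1) := by
  induction s with
  | zero =>
    have e : (0 + 2) % h = 2 := Nat.mod_eq_of_lt (by omega)
    rw [e]
    refine ⟨fun _ _ => ?_, by omega, by omega⟩
    simp [G, Finset.sum_range_succ, p0, p0', p1, p1']
  | succ s ih =>
    obtain ⟨i1, i2, i3⟩ := ih
    have e1 := succ_mod (show 2 ≤ h by omega) (s + 2)
    have g1 := G_succ p (s + 2)
    have g2 := G_succ p' (s + 2)
    rw [show s + 2 + 1 = s + 1 + 2 by omega] at e1 g1 g2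
    rw [show s + 1 + 1 = s + 2 by omega]
    by_cases m0 : (s + 2) % h = 0
    · have q := hy (s + 1) (Nat.dvd_of_mod_eq_zero m0)
      have := i2 m0
      rw [show s + 1 + 1 = s + 2 by omega] at q
      omega
    by_cases m1 : (s + 2) % h = 1
    · have hd : h ∣ s + 1 := by
        have := (Nat.modEq_iff_dvd' (show 1 ≤ s + 2 by omega)).1 (show 1 ≡ s + 2 [MOD h] by
          unfold Nat.ModEq; rw [m1, Nat.mod_eq_of_lt (by omega)])
        exact this
      have q := hy s hd
      have := i3 m1
      omega
    have i1 := i1 m0 m1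
    by_cases mm : (s + 2) % h + 1 = h
    · have q := hy (s + 2) (dvd_m1 hn hh mm)
      omega
    · have := ho _ m0 m1 mm
      omega

theorem legs0 {n h : ℕ} {lam sg lam' tau : BPartition} {c b : ℕ}
    (N : N0 n h (m lam) (m sg) (m lam') (m tau) c b) :
    legLen h tau lam' (st0 h c) = legLen h sg lam c := by
  have hn := N.hn
  have hh := N.hh
  have hc := N.an
  have c1 := N.c1
  have c2 := N.c2
  set P := pr (m lam) (m sg) with hP
  set P' := pr (m lam') (m tau) with hP'
  have p0 : P 0 = 0 := pr_zero (Or.inr (N.S0 0 (dvd_zero _)))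
  have p0' : P' 0 = 0 := pr_zero (Or.inr N.S0')
  have p1 : P 1 = 0 := pr_zero (Or.inr N.US.u4)
  have p1' : P' 1 = 1 := pr_one (by rw [N.UL.u3]) (by rw [N.US.u3])
  have hy : ∀ y, h ∣ y + 1 → P' y = 0 ∧ P' (y + 1) = 0 ∧ P' (y + 2) = P y ∧ P (y + 1) = 0 ∧ P (y + 2) = 0 := by
    intro y hd
    obtain ⟨u1, u2, u3, u4, u5⟩ := N.UL.u1 y hd
    obtain ⟨v1, v2, v3, v4, v5⟩ := N.US.u1 y hd
    have hs := N.S0 _ hd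
    refine ⟨pr_zero (Or.inl u1), pr_zero (Or.inr (by omega)), ?_, pr_zero (Or.inr hs), pr_zero (Or.inl u4)⟩
    rw [hP, hP']; unfold pr; rw [u3, v3]
  have ho : ∀ x, x % h ≠ 0 → x % h ≠ 1 → x % h + 1 ≠ h → P' x = P x := by
    intro x h1 h2 h3
    rw [hP, hP']; unfold pr; rw [N.UL.u2 x h1 h2 h3, N.US.u2 x h1 h2 h3]
  have g := G_tr0 hn hh p0 p0' p1 p1' hy ho
  have gs := G_succ P
  have gs' := G_succ P'
  have G1 : G P 1 = 0 := by simp [G, p0]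
  have G1' : G P' 1 = 0 := by simp [G, p0']
  have hsm := fun x => succ_mod (show 2 ≤ h by omega) x
  rcases st0_cases hn hh hc c2 with ⟨k1, k2, k3, k4⟩ | ⟨k1, k2⟩ <;> rw [k2]
  · rw [k2] at k3
    obtain ⟨y, rfl⟩ : ∃ y, c = y + h := ⟨c - h, by omega⟩
    have hd := dvd_m1 hn hh k1
    have hdy : h ∣ y + 1 := by
      rw [show y + h + 1 = y + 1 + h by omega] at hd
      exact Nat.dvd_add_self_right.1 hd
    have e1 := leg_big (tau := tau) (lam := lam') (show 0 < h by omega) (show h ≤ y + h + 2 by omega)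
    have e2 := leg_big (tau := sg) (lam := lam) (show 0 < h by omega) (show h ≤ y + h by omega)
    rw [← hP'] at e1
    rw [← hP] at e2
    rw [show y + h + 2 - h + 1 = y + 1 + 2 by omega] at e1
    rw [show y + h - h + 1 = y + 1 by omega] at e2
    have t1 := (g (y + h)).2.2 k3
    have t2 := gs (y + h)
    have t3 := gs (y + h + 1)
    rw [show y + h + 1 + 1 = y + h + 2 by omega] at t3
    have t4 := gs (y + 1)
    have t5 := gs (y + 2)
    rw [show y + 1 + 1 = y + 2 by omega] at t4
    rw [show y + 2 + 1 = y + 1 + 2 by omega] at t5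
    have mm := mod_m1 hn hh hdy
    have m2 := hsm (y + 2)
    rw [show y + 2 + 1 = y + 1 + 2 by omega] at m2
    have t6 := (g (y + 1)).1 (by omega) (by omega)
    have w1 := hy y hdy
    have w2 := hy (y + h) hd
    omega
  · by_cases m0 : c % h = 0
    · have hdc := Nat.dvd_of_mod_eq_zero m0
      have hch := Nat.le_of_dvd (by omega) hdc
      have z : ∀ p q : ℕ, p ≠ q → d p q = 0 := fun p q hpq => if_neg hpq
      have o : ∀ p q : ℕ, p = q → d p q = 1 := fun p q hpq => if_pos hpq
      have hbn := N.bn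
      have e1 := leg_big (tau := tau) (lam := lam') (show 0 < h by omega) hch
      have e2 := leg_big (tau := sg) (lam := lam) (show 0 < h by omega) hch
      rw [← hP'] at e1
      rw [← hP] at e2
      by_cases hceq : c = h
      · subst hceq
        rw [show c - c + 1 = 1 by omega] at e1 e2
        have t1 := (g (c - 2)).2.1 (by rw [show c - 2 + 2 = c by omega]; exact m0)
        rw [show c - 2 + 2 = c by omega, show c - 2 + 1 = c - 1 by omega] at t1
        have hPc : P (c - 1) = 1 := by
          apply pr_one _ N.Sh
          have r1 := N.rel c (by omega)
          have r2 := N.rel (c - 1) (by omega)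
          have hb2 := N.symm.c2
          have u5 := (N.UL.u1 (c - 1) (by rw [show c - 1 + 1 = c by omega])).2.2.2.2
          rw [show c - 1 + 1 = c by omega] at u5
          rw [z c (c + c) (by omega), o c c rfl] at r1
          rw [z c (c - 1 + c) (by omega), z b (c - 1) (by omega), z (b + (c - 1)) c (by omega)] at r2
          have hs := N.Sh
          by_cases hb : b = c - 1 + c
          · rw [z b (c + c) (by omega)] at r1
            exact u5 (by omega)
          · rw [z _ _ hb] at r2
            omega
        omega
      · obtain ⟨y, rfl⟩ : ∃ y, c = y + h + 1 := ⟨c - h - 1, by omega⟩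
        have hdy : h ∣ y + 1 := by
          rw [show y + h + 1 = y + 1 + h by omega] at hdc
          exact Nat.dvd_add_self_right.1 hdc
        have mm := mod_m1 hn hh hdy
        rw [show y + h + 1 - h + 1 = y + 2 by omega] at e1 e2
        have t1 := (g y).2.2 mm.2.2.1
        have t2 := (g (y + h - 1)).2.1 (by rw [show y + h - 1 + 2 = y + h + 1 by omega]; exact m0)
        rw [show y + h - 1 + 2 = y + h + 1 by omega, show y + h - 1 + 1 = y + h by omega] at t2
        have r1 := N.rel (y + 1) (by omega)
        have s1 := N.S0 _ hdy
        have s2 := N.S0 _ hdc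
        rw [o (y + h + 1) (y + 1 + h) (by omega), z (y + h + 1) (y + 1) (by omega), z (y + h + 1 + (y + 1)) h (by omega),
          z (b + (y + 1)) h (by omega)] at r1
        have hb : b = y + 1 := by
          have := d_cases b (y + 1); omega
        subst hb
        have r2 := N.rel (y + h) (by omega)
        have r3 := N.rel y (by omega)
        have r4 := N.rel (y + h + 1) (by omega)
        rw [z (y + h + 1) (y + h + h) (by omega), z (y + 1) (y + h + h) (by omega), z (y + h + 1) (y + h) (by omega),
          z (y + 1) (y + h) (by omega), z (y + h + 1 + (y + h)) h (by omega), z (y + 1 + (y + h)) h (by omega)] at r2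
        rw [z (y + h + 1) (y + h) (by omega), z (y + 1) (y + h) (by omega), z (y + h + 1) y (by omega),
          z (y + 1) y (by omega), z (y + h + 1 + y) h (by omega), z (y + 1 + y) h (by omega)] at r3
        rw [z (y + h + 1) (y + h + 1 + h) (by omega), z (y + 1) (y + h + 1 + h) (by omega), o (y + h + 1) (y + h + 1) rfl] at r4
        have u5 := (N.UL.u1 (y + h) hdc).2.2.2.2 (by omega)
        have sd := N.Sd y (by omega) (by omega)
        have z1 : P (y + h) = 1 := pr_one u5 (by omega)
        have z2 : P y = 1 := pr_one (by omega) sd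
        omega
    · have t1 := (g (c - 2)).1
      rw [show c - 2 + 2 = c by omega] at t1
      have t1 := t1 m0 c1
      by_cases hch : h ≤ c
      · obtain ⟨x, rfl⟩ : ∃ x, c = x + h := ⟨c - h, by omega⟩
        rw [Nat.add_mod_right] at *
        have hx0 : x ≠ 0 := by rintro rfl; exact m0 (Nat.zero_mod _)
        have e1 := leg_big (tau := tau) (lam := lam') (show 0 < h by omega) hch
        have e2 := leg_big (tau := sg) (lam := lam) (show 0 < h by omega) hch
        rw [← hP'] at e1
        rw [← hP] at e2
        rw [show x + h - h + 1 = x - 1 + 2 by omega] at e1 e2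
        have ms := hsm x
        rw [show x + 1 = x - 1 + 2 by omega] at ms
        have t2 := (g (x - 1)).1 (by omega) (by omega)
        omega
      · have e1 := leg_small (tau := tau) (lam := lam') hh hc (by omega)
        have e2 := leg_small (tau := sg) (lam := lam) hh hc (by omega)
        rw [← hP'] at e1
        rw [← hP] at e2
        rw [show h - c + 1 = h - c - 1 + 2 by omega] at e1 e2
        have ms : (h - c - 1 + 2) % h = h - c - 1 + 2 := Nat.mod_eq_of_lt (by omega)
        have t2 := (g (h - c - 1)).1 (by omega) (by omega)
        omega

theorem case0 {n h : ℕ} (hn : 1 ≤ n) (hh : h = 2 * n + 1) {sg lam : BPartition}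
    (hc : IsBarCore h sg) (hadd : 2 ≤ Set.ncard {y | Addable h 0 sg y}) (hs : IsHStrict h lam)
    (hunex : ∀ x, ¬ Removable h 0 lam x)
    {a b a' b' : ℕ} (hab : BarPositions h sg lam a b)
    (hab' : BarPositions h (psi h 0 sg) (psi h 0 lam) a' b') :
    ddd h (psi h 0 sg) (psi h 0 lam) a' b' = ddd h sg lam a b := by
  obtain ⟨c1, c2, c3⟩ := core_facts hh hc
  obtain ⟨s1, s3⟩ := sigma_facts0 hn hh hc hadd
  obtain ⟨u1, u2, u3, u4⟩ := psi_m0 hn hh hc.1 s3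
  obtain ⟨w1, w2, w3, w4⟩ := psi_m0 hn hh hs hunex
  obtain ⟨x1, x2, x3⟩ := rel_of_bar hh hab
  obtain ⟨y1, y2, y3⟩ := rel_of_bar hh hab'
  have N : N0 n h (m lam) (m sg) (m (psi h 0 lam)) (m (psi h 0 sg)) a b :=
    ⟨hn, hh, ⟨w1, w2, w3, w4⟩, ⟨u1, u2, u3, u4⟩, c1, m_zero _, c2, s1, x1, x2, x3⟩
  have l1 := legs0 N
  have l2 := legs0 N.symm
  have r := N.relst
  unfold ddd
  rcases rel_uniq hh (st0_gt x1) y1 (st0_gt x2) y2 r y3 with ⟨rfl, rfl⟩ | ⟨rfl, rfl⟩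
  · rw [l1, l2]
  · rw [l1, l2, max_comm, min_comm]

end BPartition

open BPartition in
/-- In a [2:k]-pair (P_{σ,2}, P_{τ,2}) of residue i with i ≥ 1 or k ≥ 3, if
λ ∈ P_{σ,2} is unexceptional then ∂ψ_i(λ) = ∂λ. -/
theorem stmt14 (n h : ℕ) (hn : 1 ≤ n) (hh : h = 2 * n + 1) (i k : ℕ) (hi : i ≤ n)
    (hk : 1 ≤ k) (σ : BPartition) (hσ : IsBarCore h σ)
    (hcnt : Set.ncard {x : ℕ × ℕ | Addable h i σ x} = k)
    (τ : BPartition) (hτ : τ = psi h i σ) (hik : 1 ≤ i ∨ 3 ≤ k)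
    (lam : BPartition) (h1 : InBlock h σ 2 lam) (hunex : ∀ x, ¬ Removable h i lam x)
    (a b a' b' : ℕ) (hab : BarPositions h σ lam a b)
    (hab' : BarPositions h τ (psi h i lam) a' b') :
    ddd h τ (psi h i lam) a' b' = ddd h σ lam a b := by
  subst hτ
  rcases Nat.eq_zero_or_pos i with h0 | h0
  · subst h0
    exact case0 hn hh hσ (by omega) h1.1 hunex hab hab'
  · have hne : ∃ y, Addable h i σ y := by
      by_contra hcon
      have : {x : ℕ × ℕ | Addable h i σ x} = ∅ := by
        ext x
        simp only [Set.mem_ofPred_eq, Set.mem_empty_iff_false, iff_false]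
        exact fun q => hcon ⟨x, q⟩
      rw [this, Set.ncard_empty] at hcnt
      omega
    exact case1 hn hh h0 hi hσ hne h1.1 hunex hab hab'
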